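/- Consider the 3-dimensional system (S): u' = c₁u + c₂u² + c₃uv + c₄uw + c₅vw + h(v,w), v' = μv − ωw + c₆uv + c₇uw + f(v,w), w' = ωv + μw + c₈uv + c₉uw + g(v,w), and assume c₁ ≠ 0 and σ_# ≠ 0. Then there exist ε, δ, C > 0 such that for every μ with 0 < |μ| < ε: (i) if μ·σ_# < 0, the system (S) has a nonconstant periodic solution (u,v,w) : ℝ → ℝ³ with 0 < sup_t √(v(t)² + w(t)²) < δ, satisfying |sup_t √(v(t)² + w(t)²) + 3πμ/(2σ_#)| ≤ C·μ² and sup_t |u(t)| ≤ C·μ²; any two nonconstant periodic solutions of (S) whose orbits lie in the δ-ball around the origin coincide up to a time translation; (ii) if μ·σ_# > 0, the system (S) has no nonconstant periodic solution whose orbit lies in the δ-ball around the origin. In particular, the conclusion of the planar degenerate Hopf bifurcation theorem persists in the presence of a transversally hyperbolic direction, and the u-component of the bifurcating orbit is of order O(μ²). -/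

import Mathlib

open Real Set

/-- A (global) solution of the autonomous ODE `x' = F(x)` on `ℝ³ = ℝ × ℝ × ℝ`. -/
def IsSolution3 (F : ℝ × ℝ × ℝ → ℝ × ℝ × ℝ) (x : ℝ → ℝ × ℝ × ℝ) : Prop :=
  ∀ t, HasDerivAt x (F (x t)) t

/-- A nonconstant periodic solution of `x' = F(x)`. -/
def IsPeriodicSolution3 (F : ℝ × ℝ × ℝ → ℝ × ℝ × ℝ) (x : ℝ → ℝ × ℝ × ℝ) : Prop :=
  IsSolution3 F x ∧ (∃ T > 0, ∀ t, x (t + T) = x t) ∧ ¬ (∀ t, x t = x 0)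

/-- The planar amplitude `sup_t √(v(t)² + w(t)²)` of the `(v,w)`-components of a curve
`t ↦ (u(t), v(t), w(t))`. -/
noncomputable def ampl3 (x : ℝ → ℝ × ℝ × ℝ) : ℝ :=
  ⨆ t : ℝ, Real.sqrt ((x t).2.1 ^ 2 + (x t).2.2 ^ 2)

/-- A differentiable periodic function attains its maximal modulus at a critical point. -/
lemma exists_crit_max {φ φ' : ℝ → ℝ} {T : ℝ} (hT : 0 < T) (hper : ∀ t, φ (t + T) = φ t)
    (hd : ∀ t, HasDerivAt φ (φ' t) t) : ∃ t0, φ' t0 = 0 ∧ ∀ t, |φ t| ≤ |φ t0| := by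
  have hc : Continuous φ := continuous_iff_continuousAt.2 fun t => (hd t).continuousAt
  obtain ⟨t0, -, h0⟩ := (isCompact_Icc (a := (0 : ℝ)) (b := T)).exists_isMaxOn
    ⟨0, by simp [hT.le]⟩ (hc.abs.continuousOn)
  have hall : ∀ t, |φ t| ≤ |φ t0| := by
    intro t
    obtain ⟨y, hy, hy'⟩ := Function.Periodic.exists_mem_Ico₀ (f := φ) (c := T) hper hT t
    rw [hy']
    exact h0 (Ico_subset_Icc_self hy)
  refine ⟨t0, ?_, hall⟩
  by_cases hz : φ t0 = 0
  · have hzero : φ = fun _ => 0 := by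
      funext t
      have := hall t
      rw [hz, abs_zero] at this
      exact abs_eq_zero.1 (le_antisymm this (abs_nonneg _))
    have h1 := hd t0
    rw [hzero] at h1
    exact h1.unique (hasDerivAt_const t0 (0 : ℝ))
  · have h1 : IsLocalMax (fun t => φ t ^ 2) t0 :=
      Filter.Eventually.of_forall fun t => sq_le_sq.2 (hall t)
    have h2 := h1.hasDerivAt_eq_zero ((hd t0).pow 2)
    simp [hz] at h2
    exact h2

/-- Maximum principle for periodic functions. -/
lemma max_principle {φ φ' : ℝ → ℝ} {T l K M : ℝ} (hT : 0 < T) (hper : ∀ t, φ (t + T) = φ t)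
    (hd : ∀ t, HasDerivAt φ (φ' t) t) (hM : M ≤ |l|)
    (hb : ∀ t, |φ' t - l * φ t| ≤ K + M * |φ t|) (t : ℝ) : (|l| - M) * |φ t| ≤ K := by
  obtain ⟨t0, h0, hall⟩ := exists_crit_max hT hper hd
  have h1 := hb t0
  rw [h0, zero_sub, abs_neg, abs_mul] at h1
  have h2 := mul_le_mul_of_nonneg_left (hall t) (sub_nonneg.2 hM)
  linarith

/-- Global inverse of a function with derivative bounded away from zero. -/
lemma global_inverse {f f' : ℝ → ℝ} {w c : ℝ} (hc : 0 < c)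
    (hd : ∀ t, HasDerivAt f (f' t) t) (hf : ∀ t, c ≤ w * f' t) :
    ∃ g : ℝ → ℝ, (∀ x, f (g x) = x) ∧ (∀ x, g (f x) = x) ∧
      ∀ x, HasDerivAt g (f' (g x))⁻¹ x := by
  have hw : w ≠ 0 := by
    rintro rfl
    have := hf 0
    linarith
  have hdk : ∀ t, HasDerivAt (fun t => w * f t) (w * f' t) t := fun t => (hd t).const_mul w
  have hmono : StrictMono (fun t => w * f t) :=
    strictMono_of_hasDerivAt_pos hdk fun t => lt_of_lt_of_le hc (hf t)
  have hmono2 : Monotone (fun t => w * f t - c * t) := by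
    have hd2 : ∀ t, HasDerivAt (fun t => w * f t - c * t) (w * f' t - c * 1) t :=
      fun t => (hdk t).sub ((hasDerivAt_id t).const_mul c)
    refine monotone_of_deriv_nonneg (fun t => (hd2 t).differentiableAt) fun t => ?_
    rw [(hd2 t).deriv]
    linarith [hf t]
  have hcont : Continuous (fun t => w * f t) :=
    continuous_iff_continuousAt.2 fun t => (hdk t).continuousAt
  have hsurj : Function.Surjective (fun t => w * f t) := by
    refine hcont.surjective ?_ ?_
    · refine Filter.tendsto_atTop_mono' Filter.atTop ?_
        ((Filter.tendsto_id.const_mul_atTop hc).atTop_add (tendsto_const_nhds (x := w * f 0)))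
      filter_upwards [Filter.eventually_ge_atTop 0] with t ht
      have := hmono2 ht
      simp at this ⊢
      linarith
    · refine Filter.tendsto_atBot_mono' Filter.atBot ?_
        ((Filter.tendsto_id.const_mul_atBot hc).atBot_add (tendsto_const_nhds (x := w * f 0)))
      filter_upwards [Filter.eventually_le_atBot 0] with t ht
      have := hmono2 ht
      simp at this ⊢
      linarith
  let e := hmono.orderIsoOfSurjective _ hsurj
  have he : ∀ t, e t = w * f t := fun t => rfl
  have h1 : ∀ x, f (e.symm (w * x)) = x := by
    intro x
    have := e.apply_symm_apply (w * x)
    rw [he] at this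
    exact mul_left_cancel₀ hw this
  refine ⟨fun x => e.symm (w * x), h1, ?_, ?_⟩
  · intro x
    show e.symm (w * f x) = x
    rw [← he]
    exact e.symm_apply_apply x
  · intro x
    have hcg : Continuous (fun x => e.symm (w * x)) :=
      e.symm.continuous.comp (continuous_const.mul continuous_id)
    refine HasDerivAt.of_local_left_inverse hcg.continuousAt (hd _) ?_
      (Filter.Eventually.of_forall h1)
    intro h0
    have := hf (e.symm (w * x))
    rw [h0] at this
    linarith

/-- The periodic solution of `q' = l q + g` . -/
noncomputable def psol (l : ℝ) (g : ℝ → ℝ) (θ : ℝ) : ℝ :=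
  exp (l * θ) / (exp (-l * (2 * π)) - 1) * ∫ s in θ..(θ + 2 * π), exp (-l * s) * g s

lemma psol_den {l : ℝ} (hl : l ≠ 0) : exp (-l * (2 * π)) - 1 ≠ 0 := by
  intro h
  have h1 : exp (-l * (2 * π)) = 1 := by linarith
  rw [Real.exp_eq_one_iff] at h1
  have := Real.pi_pos
  rcases mul_eq_zero.1 h1 with h | h
  · exact hl (by linarith)
  · linarith

lemma psol_hasDerivAt' (l : ℝ) {g : ℝ → ℝ} (hg : Continuous g) (hl : l ≠ 0) (θ : ℝ) :
    HasDerivAt (psol l g) (l * psol l g θ +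
      (exp (-l * (2 * π)) * g (θ + 2 * π) - g θ) / (exp (-l * (2 * π)) - 1)) θ := by
  have hc : Continuous (fun s => exp (-l * s) * g s) := by fun_prop
  have hI : ∀ x, HasDerivAt (fun x => ∫ s in (0:ℝ)..x, exp (-l * s) * g s)
      (exp (-l * x) * g x) x := fun x =>
    intervalIntegral.integral_hasDerivAt_right (hc.intervalIntegrable _ _)
      hc.aestronglyMeasurable.stronglyMeasurableAtFilter hc.continuousAt
  have h1 : HasDerivAt (fun θ => ∫ s in θ..(θ + 2 * π), exp (-l * s) * g s)
      (exp (-l * (θ + 2 * π)) * g (θ + 2 * π) - exp (-l * θ) * g θ) θ := by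
    have h2 := (HasDerivAt.comp_add_const θ (2 * π) (hI (θ + 2 * π))).sub (hI θ)
    refine h2.congr_of_eventuallyEq (Filter.Eventually.of_forall fun x => ?_)
    exact (intervalIntegral.integral_interval_sub_left (hc.intervalIntegrable _ _)
      (hc.intervalIntegrable _ _)).symm
  have h3 : HasDerivAt (fun θ => exp (l * θ) / (exp (-l * (2 * π)) - 1))
      (exp (l * θ) * (l * 1) / (exp (-l * (2 * π)) - 1)) θ :=
    (((hasDerivAt_id θ).const_mul l).exp).div_const _
  have h4 := h3.mul h1
  refine h4.congr_deriv ?_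
  have hden := psol_den hl
  have e1 : exp (l * θ) * exp (-l * (θ + 2 * π)) = exp (-l * (2 * π)) := by
    rw [← Real.exp_add]; congr 1; ring
  have e2 : exp (l * θ) * exp (-l * θ) = 1 := by
    rw [← Real.exp_add]; simp
  have e3 : exp (l * θ) / (exp (-l * (2 * π)) - 1) *
      (exp (-l * (θ + 2 * π)) * g (θ + 2 * π) - exp (-l * θ) * g θ) =
      (exp (-l * (2 * π)) * g (θ + 2 * π) - g θ) / (exp (-l * (2 * π)) - 1) := by
    rw [← e1]
    rw [div_mul_eq_mul_div]
    congr 1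
    linear_combination (-g θ) * e2
  rw [e3, psol]
  ring

lemma psol_hasDerivAt {l : ℝ} {g : ℝ → ℝ} (hg : Continuous g) (hl : l ≠ 0)
    (hper : ∀ θ, g (θ + 2 * π) = g θ) (θ : ℝ) :
    HasDerivAt (psol l g) (l * psol l g θ + g θ) θ := by
  refine (psol_hasDerivAt' l hg hl θ).congr_deriv ?_
  have := psol_den hl
  rw [hper]
  generalize exp (-l * (2 * π)) = e at *
  field_simp

lemma psol_continuous (l : ℝ) {g : ℝ → ℝ} (hg : Continuous g) (hl : l ≠ 0) :
    Continuous (psol l g) :=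
  continuous_iff_continuousAt.2 fun θ => (psol_hasDerivAt' l hg hl θ).continuousAt

lemma psol_bound {l K : ℝ} {g : ℝ → ℝ} (hl : l ≠ 0)
    (hK : ∀ θ, |g θ| ≤ K) (θ : ℝ) : |psol l g θ| ≤ K / |l| := by
  have hden := psol_den hl
  have h1 : ‖∫ s in θ..(θ + 2 * π), exp (-l * s) * g s‖ ≤
      ∫ s in θ..(θ + 2 * π), exp (-l * s) * K := by
    refine intervalIntegral.norm_integral_le_of_norm_le (by linarith [Real.pi_pos]) ?_ ?_
    · refine Filter.Eventually.of_forall fun s _ => ?_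
      rw [norm_mul, Real.norm_of_nonneg (exp_pos _).le]
      exact mul_le_mul_of_nonneg_left (hK s) (exp_pos _).le
    · exact (by fun_prop : Continuous fun s => exp (-l * s) * K).intervalIntegrable _ _
  have h2 : ∫ s in θ..(θ + 2 * π), exp (-l * s) * K =
      exp (-l * θ) * (1 - exp (-l * (2 * π))) / l * K := by
    have hd : ∀ s ∈ uIcc θ (θ + 2 * π),
        HasDerivAt (fun s => -(exp (-l * s) / l) * K) (exp (-l * s) * K) s := by
      intro s _
      have := ((((hasDerivAt_id s).const_mul (-l)).exp.div_const l).neg).mul_const K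
      refine this.congr_deriv ?_
      simp
      field_simp
    rw [intervalIntegral.integral_eq_sub_of_hasDerivAt hd
      ((by fun_prop : Continuous fun s => exp (-l * s) * K).intervalIntegrable _ _)]
    rw [show -l * (θ + 2 * π) = -l * θ + -l * (2 * π) by ring, Real.exp_add]
    field_simp
    ring
  have hK0 : 0 ≤ K := (abs_nonneg _).trans (hK 0)
  rw [psol, abs_mul, abs_div, abs_of_pos (exp_pos _)]
  rw [h2] at h1
  have h3 : exp (-l * θ) * (1 - exp (-l * (2 * π))) / l * K ≤
      exp (-l * θ) * |exp (-l * (2 * π)) - 1| / |l| * K := by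
    refine mul_le_mul_of_nonneg_right ?_ hK0
    refine (le_abs_self _).trans ?_
    rw [abs_div, abs_mul, abs_of_pos (exp_pos _), abs_sub_comm]
  have e2 : exp (l * θ) * exp (-l * θ) = 1 := by
    rw [← Real.exp_add]; simp
  have hden' := abs_pos.2 hden
  calc exp (l * θ) / |exp (-l * (2 * π)) - 1| * |∫ s in θ..(θ + 2 * π), exp (-l * s) * g s|
      ≤ exp (l * θ) / |exp (-l * (2 * π)) - 1| *
        (exp (-l * θ) * |exp (-l * (2 * π)) - 1| / |l| * K) := by
        refine mul_le_mul_of_nonneg_left (h1.trans h3) ?_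
        exact div_nonneg (exp_pos _).le hden'.le
    _ = (exp (l * θ) * exp (-l * θ)) * K / |l| := by
        generalize exp (-l * θ) = e1
        generalize exp (l * θ) = e2
        generalize |exp (-l * (2 * π)) - 1| = e3 at *
        have hl' := abs_pos.2 hl
        field_simp
    _ = K / |l| := by rw [e2, one_mul]

lemma psol_sub (l : ℝ) {g g' : ℝ → ℝ} (hg : Continuous g) (hg' : Continuous g') (θ : ℝ) :
    psol l g θ - psol l g' θ = psol l (fun s => g s - g' s) θ := by
  unfold psol
  rw [← mul_sub, ← intervalIntegral.integral_sub]
  · congr 1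
    refine intervalIntegral.integral_congr fun s _ => ?_
    simp only
    ring
  · exact (by fun_prop : Continuous fun s => exp (-l * s) * g s).intervalIntegrable _ _
  · exact (by fun_prop : Continuous fun s => exp (-l * s) * g' s).intervalIntegrable _ _

lemma psol_shift (l : ℝ) (g : ℝ → ℝ) (a θ : ℝ) :
    psol l g (θ + a) = psol l (fun s => g (s + a)) θ := by
  unfold psol
  have h1 : ∫ s in (θ + a)..(θ + a + 2 * π), exp (-l * s) * g s =
      ∫ s in θ..(θ + 2 * π), exp (-l * (s + a)) * g (s + a) := by
    rw [intervalIntegral.integral_comp_add_right (fun s => exp (-l * s) * g s)]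
    congr 1; ring
  have h2 : ∫ s in θ..(θ + 2 * π), exp (-l * (s + a)) * g (s + a) =
      exp (-l * a) * ∫ s in θ..(θ + 2 * π), exp (-l * s) * g (s + a) := by
    rw [← intervalIntegral.integral_const_mul]
    refine intervalIntegral.integral_congr fun s _ => ?_
    show exp (-l * (s + a)) * g (s + a) = exp (-l * a) * (exp (-l * s) * g (s + a))
    rw [show -l * (s + a) = -l * a + -l * s by ring, Real.exp_add]
    ring
  rw [h1, h2]
  have : exp (l * θ) = exp (l * (θ + a)) * exp (-l * a) := by
    rw [← Real.exp_add]; congr 1; ring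
  rw [this]
  ring

/-- Existence of periodic solutions of weakly coupled systems by contraction. -/
lemma exists_periodic {l₁ l₂ : ℝ} (hl₁ : l₁ ≠ 0) (hl₂ : l₂ ≠ 0) {g₁ g₂ : ℝ → ℝ → ℝ → ℝ}
    (hc₁ : Continuous fun p : ℝ × ℝ × ℝ => g₁ p.1 p.2.1 p.2.2)
    (hc₂ : Continuous fun p : ℝ × ℝ × ℝ => g₂ p.1 p.2.1 p.2.2)
    {K : ℝ} (hK₁ : ∀ θ Q y, |g₁ θ Q y| ≤ K) (hK₂ : ∀ θ Q y, |g₂ θ Q y| ≤ K)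
    (hL₁ : ∀ θ Q y Q' y', |g₁ θ Q y - g₁ θ Q' y'| ≤ |l₁| / 2 * max |Q - Q'| |y - y'|)
    (hL₂ : ∀ θ Q y Q' y', |g₂ θ Q y - g₂ θ Q' y'| ≤ |l₂| / 2 * max |Q - Q'| |y - y'|)
    (hp₁ : ∀ θ Q y, g₁ (θ + 2 * π) Q y = g₁ θ Q y)
    (hp₂ : ∀ θ Q y, g₂ (θ + 2 * π) Q y = g₂ θ Q y) :
    ∃ Q y : ℝ → ℝ, (∀ θ, Q (θ + 2 * π) = Q θ) ∧ (∀ θ, y (θ + 2 * π) = y θ) ∧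
      (∀ θ, HasDerivAt Q (l₁ * Q θ + g₁ θ (Q θ) (y θ)) θ) ∧
      (∀ θ, HasDerivAt y (l₂ * y θ + g₂ θ (Q θ) (y θ)) θ) := by
  let N₁ : (ℝ → ℝ × ℝ) → ℝ → ℝ := fun f s => g₁ s (f s).1 (f s).2
  let N₂ : (ℝ → ℝ × ℝ) → ℝ → ℝ := fun f s => g₂ s (f s).1 (f s).2
  have hN₁ : ∀ f : ℝ → ℝ × ℝ, Continuous f → Continuous (N₁ f) := fun f hf =>
    hc₁.comp (continuous_id.prodMk hf)
  have hN₂ : ∀ f : ℝ → ℝ × ℝ, Continuous f → Continuous (N₂ f) := fun f hf =>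
    hc₂.comp (continuous_id.prodMk hf)
  let Tf : (ℝ → ℝ × ℝ) → ℝ → ℝ × ℝ := fun f θ => (psol l₁ (N₁ f) θ, psol l₂ (N₂ f) θ)
  have hTc : ∀ f : ℝ → ℝ × ℝ, Continuous f → Continuous (Tf f) := fun f hf =>
    (psol_continuous l₁ (hN₁ f hf) hl₁).prodMk (psol_continuous l₂ (hN₂ f hf) hl₂)
  have hTb : ∀ f : ℝ → ℝ × ℝ, ∀ θ, ‖Tf f θ‖ ≤ max (K / |l₁|) (K / |l₂|) := by
    intro f θ
    exact max_le_max (psol_bound hl₁ (fun s => hK₁ _ _ _) θ)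
      (psol_bound hl₂ (fun s => hK₂ _ _ _) θ)
  let T : BoundedContinuousFunction ℝ (ℝ × ℝ) → BoundedContinuousFunction ℝ (ℝ × ℝ) := fun f =>
    BoundedContinuousFunction.ofNormedAddCommGroup (Tf f) (hTc f f.continuous) _ (hTb f)
  have hTapp : ∀ f θ, T f θ = Tf f θ := fun f θ => rfl
  have hcontr : ContractingWith (1 / 2 : NNReal) T := by
    refine ⟨by rw [div_lt_one] <;> norm_num, LipschitzWith.of_dist_le_mul fun f f' => ?_⟩
    have hcoe : ((1 / 2 : NNReal) : ℝ) = 1 / 2 := by norm_num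
    rw [hcoe]
    refine (BoundedContinuousFunction.dist_le (by positivity)).2 fun θ => ?_
    have hd : ∀ s, max |(f s).1 - (f' s).1| |(f s).2 - (f' s).2| ≤ dist f f' := fun s =>
      BoundedContinuousFunction.dist_coe_le_dist (f := f) (g := f') s
    rw [hTapp, hTapp, Prod.dist_eq]
    refine max_le ?_ ?_
    · show |psol l₁ (N₁ f) θ - psol l₁ (N₁ f') θ| ≤ _
      rw [psol_sub l₁ (hN₁ f f.continuous) (hN₁ f' f'.continuous)]
      refine (psol_bound (K := |l₁| / 2 * dist f f') hl₁ (fun s => ?_) θ).trans (le_of_eq ?_)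
      · exact (hL₁ _ _ _ _ _).trans (mul_le_mul_of_nonneg_left (hd s) (by positivity))
      · have := abs_pos.2 hl₁
        field_simp
    · show |psol l₂ (N₂ f) θ - psol l₂ (N₂ f') θ| ≤ _
      rw [psol_sub l₂ (hN₂ f f.continuous) (hN₂ f' f'.continuous)]
      refine (psol_bound (K := |l₂| / 2 * dist f f') hl₂ (fun s => ?_) θ).trans (le_of_eq ?_)
      · exact (hL₂ _ _ _ _ _).trans (mul_le_mul_of_nonneg_left (hd s) (by positivity))
      · have := abs_pos.2 hl₂
        field_simp
  obtain ⟨f, hf⟩ : ∃ f, T f = f := ⟨_, hcontr.fixedPoint_isFixedPt⟩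
  have hfT : ∀ θ, f θ = Tf f θ := fun θ => by rw [← hTapp, hf]
  let f' : BoundedContinuousFunction ℝ (ℝ × ℝ) :=
    f.compContinuous ⟨fun θ => θ + 2 * π, by fun_prop⟩
  have hf'app : ∀ θ, f' θ = f (θ + 2 * π) := fun θ => rfl
  have hf' : T f' = f' := by
    ext1 θ
    rw [hTapp, hf'app, hfT (θ + 2 * π)]
    show (psol l₁ (N₁ f') θ, psol l₂ (N₂ f') θ) = (psol l₁ (N₁ f) _, psol l₂ (N₂ f) _)
    rw [psol_shift, psol_shift]
    have e1 : N₁ f' = fun s => N₁ f (s + 2 * π) := by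
      funext s
      exact (hp₁ s _ _).symm
    have e2 : N₂ f' = fun s => N₂ f (s + 2 * π) := by
      funext s
      exact (hp₂ s _ _).symm
    rw [e1, e2]
  have hff' : f' = f := hcontr.fixedPoint_unique' hf' hf
  have hper : ∀ θ, f (θ + 2 * π) = f θ := fun θ => by rw [← hf'app, hff']
  have hQ : (fun θ => (f θ).1) = psol l₁ (N₁ f) := by
    funext θ; rw [hfT]
  have hy : (fun θ => (f θ).2) = psol l₂ (N₂ f) := by
    funext θ; rw [hfT]
  refine ⟨fun θ => (f θ).1, fun θ => (f θ).2, fun θ => by simp only [hper],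
    fun θ => by simp only [hper], fun θ => ?_, fun θ => ?_⟩
  · have := psol_hasDerivAt (hN₁ f f.continuous) hl₁ (fun s => by simp only [N₁, hper, hp₁]) θ
    rw [← hQ] at this
    exact this
  · have := psol_hasDerivAt (hN₂ f f.continuous) hl₂ (fun s => by simp only [N₂, hper, hp₂]) θ
    rw [← hy] at this
    exact this

/-- Clamping to an interval. -/
noncomputable def clamp (a b x : ℝ) : ℝ := max a (min b x)

lemma clamp_lip (a b x x' : ℝ) : |clamp a b x - clamp a b x'| ≤ |x - x'| := by
  unfold clamp
  rw [abs_le]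
  have h1 := neg_abs_le (x - x')
  have h2 := le_abs_self (x - x')
  have h3 := abs_nonneg (x - x')
  constructor <;>
  · rcases max_cases a (min b x) with h | h <;> rcases max_cases a (min b x') with h' | h' <;>
    rcases min_cases b x with k | k <;> rcases min_cases b x' with k' | k' <;> linarith

lemma clamp_mem {a b : ℝ} (hab : a ≤ b) (x : ℝ) : a ≤ clamp a b x ∧ clamp a b x ≤ b :=
  ⟨le_max_left _ _, max_le hab (min_le_left _ _)⟩

lemma clamp_eq {a b x : ℝ} (h1 : a ≤ x) (h2 : x ≤ b) : clamp a b x = x := by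
  unfold clamp
  rw [min_eq_right h2, max_eq_right h1]

lemma clamp_continuous (a b : ℝ) : Continuous (clamp a b) := by
  unfold clamp
  fun_prop

/-- Families of uniformly bounded, uniformly Lipschitz functions. -/
def BL (m0 : ℝ) (φ : ℝ → ℝ → ℝ → ℝ → ℝ) : Prop :=
  ∃ K, 0 ≤ K ∧ ∀ m θ, |m| ≤ m0 → (∀ Q y, |φ m θ Q y| ≤ K) ∧
    ∀ Q y Q' y', |φ m θ Q y - φ m θ Q' y'| ≤ K * max |Q - Q'| |y - y'|

lemma BL.mono {m0 m1 : ℝ} {φ} (h : BL m0 φ) (hm : m1 ≤ m0) : BL m1 φ := by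
  obtain ⟨K, hK, h⟩ := h
  exact ⟨K, hK, fun m θ hm' => h m θ (hm'.trans hm)⟩

lemma BL.add {m0 : ℝ} {φ ψ} (h : BL m0 φ) (h' : BL m0 ψ) :
    BL m0 (fun m θ Q y => φ m θ Q y + ψ m θ Q y) := by
  obtain ⟨K, hK, h⟩ := h
  obtain ⟨K', hK', h'⟩ := h'
  refine ⟨K + K', by positivity, fun m θ hm => ⟨fun Q y => ?_, fun Q y Q' y' => ?_⟩⟩
  · exact (abs_add_le _ _).trans (add_le_add ((h m θ hm).1 Q y) ((h' m θ hm).1 Q y))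
  · have e1 := (h m θ hm).2 Q y Q' y'
    have e2 := (h' m θ hm).2 Q y Q' y'
    have : φ m θ Q y + ψ m θ Q y - (φ m θ Q' y' + ψ m θ Q' y') =
      (φ m θ Q y - φ m θ Q' y') + (ψ m θ Q y - ψ m θ Q' y') := by ring
    rw [this, add_mul]
    exact (abs_add_le _ _).trans (add_le_add e1 e2)

lemma BL.mul {m0 : ℝ} {φ ψ} (h : BL m0 φ) (h' : BL m0 ψ) :
    BL m0 (fun m θ Q y => φ m θ Q y * ψ m θ Q y) := by
  obtain ⟨K, hK, h⟩ := h
  obtain ⟨K', hK', h'⟩ := h'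
  refine ⟨2 * (K * K'), by positivity, fun m θ hm => ⟨fun Q y => ?_, fun Q y Q' y' => ?_⟩⟩
  · rw [abs_mul]
    have := mul_le_mul ((h m θ hm).1 Q y) ((h' m θ hm).1 Q y) (abs_nonneg _) hK
    have h0 : 0 ≤ K * K' := by positivity
    linarith
  · have e1 := (h m θ hm).2 Q y Q' y'
    have e2 := (h' m θ hm).2 Q y Q' y'
    have b1 := (h m θ hm).1 Q' y'
    have b2 := (h' m θ hm).1 Q y
    have : φ m θ Q y * ψ m θ Q y - φ m θ Q' y' * ψ m θ Q' y' =
      (φ m θ Q y - φ m θ Q' y') * ψ m θ Q y + φ m θ Q' y' * (ψ m θ Q y - ψ m θ Q' y') := by ring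
    rw [this]
    refine (abs_add_le _ _).trans ?_
    rw [abs_mul, abs_mul]
    have hM : 0 ≤ max |Q - Q'| |y - y'| := le_max_of_le_left (abs_nonneg _)
    have k1 := mul_le_mul e1 b2 (abs_nonneg _) (by positivity)
    have k2 := mul_le_mul b1 e2 (abs_nonneg _) hK
    nlinarith

lemma BL.fn {m0 : ℝ} {f : ℝ → ℝ} {K : ℝ} (hf : ∀ θ, |f θ| ≤ K) : BL m0 (fun _ θ _ _ => f θ) := by
  have hK : 0 ≤ K := (abs_nonneg _).trans (hf 0)
  refine ⟨K, hK, fun m θ _ => ⟨fun _ _ => hf θ, fun Q y Q' y' => ?_⟩⟩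
  simp only [sub_self, abs_zero]
  exact mul_nonneg hK (le_max_of_le_left (abs_nonneg _))

lemma BL.const {m0 : ℝ} (c : ℝ) : BL m0 (fun _ _ _ _ => c) :=
  BL.fn (f := fun _ => c) fun _ => le_rfl

lemma BL.m {m0 : ℝ} (h0 : 0 ≤ m0) : BL m0 (fun m _ _ _ => m) := by
  refine ⟨m0, h0, fun m θ hm => ⟨fun _ _ => hm, fun Q y Q' y' => ?_⟩⟩
  simp only [sub_self, abs_zero]
  exact mul_nonneg h0 (le_max_of_le_left (abs_nonneg _))

lemma BL.sub {m0 : ℝ} {φ ψ} (h : BL m0 φ) (h' : BL m0 ψ) :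
    BL m0 (fun m θ Q y => φ m θ Q y - ψ m θ Q y) := by
  have := h.add ((BL.const (-1)).mul h')
  simpa [sub_eq_add_neg] using this

lemma BL.inv {m0 c : ℝ} {φ} (h : BL m0 φ) (hc : 0 < c)
    (hφ : ∀ m θ Q y, |m| ≤ m0 → c ≤ |φ m θ Q y|) :
    BL m0 (fun m θ Q y => (φ m θ Q y)⁻¹) := by
  obtain ⟨K, hK, h⟩ := h
  refine ⟨c⁻¹ + K * (c⁻¹ * c⁻¹), by positivity, fun m θ hm => ⟨fun Q y => ?_, fun Q y Q' y' => ?_⟩⟩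
  · rw [abs_inv]
    have := inv_anti₀ hc (hφ m θ Q y hm)
    have h0 : 0 ≤ K * (c⁻¹ * c⁻¹) := by positivity
    linarith
  · have i1 := inv_anti₀ hc (hφ m θ Q y hm)
    have i2 := inv_anti₀ hc (hφ m θ Q' y' hm)
    have n1 : φ m θ Q y ≠ 0 := abs_pos.1 (hc.trans_le (hφ m θ Q y hm))
    have n2 : φ m θ Q' y' ≠ 0 := abs_pos.1 (hc.trans_le (hφ m θ Q' y' hm))
    have e1 := (h m θ hm).2 Q y Q' y'
    rw [inv_sub_inv n1 n2, abs_div, abs_mul, abs_sub_comm, div_eq_mul_inv, mul_inv]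
    have hM : 0 ≤ max |Q - Q'| |y - y'| := le_max_of_le_left (abs_nonneg _)
    have k1 : |φ m θ Q y|⁻¹ * |φ m θ Q' y'|⁻¹ ≤ c⁻¹ * c⁻¹ :=
      mul_le_mul i1 i2 (by positivity) (by positivity)
    have k2 := mul_le_mul e1 k1 (by positivity) (by positivity)
    have k3 : 0 ≤ c⁻¹ * max |Q - Q'| |y - y'| := by positivity
    nlinarith

lemma BL.clampQ {m0 a b : ℝ} (hab : a ≤ b) : BL m0 (fun _ _ Q _ => clamp a b Q) := by
  refine ⟨1 + max |a| |b|, by positivity, fun m θ _ => ⟨fun Q _ => ?_, fun Q y Q' y' => ?_⟩⟩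
  · have := abs_le_max_abs_abs (clamp_mem hab Q).1 (clamp_mem hab Q).2
    linarith
  · have h1 := (clamp_lip a b Q Q').trans (le_max_left _ |y - y'|)
    have h2 : 0 ≤ max |a| |b| * max |Q - Q'| |y - y'| := by positivity
    linarith

lemma BL.clampy {m0 a b : ℝ} (hab : a ≤ b) : BL m0 (fun _ _ _ y => clamp a b y) := by
  refine ⟨1 + max |a| |b|, by positivity, fun m θ _ => ⟨fun _ y => ?_, fun Q y Q' y' => ?_⟩⟩
  · have := abs_le_max_abs_abs (clamp_mem hab y).1 (clamp_mem hab y).2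
    linarith
  · have h1 := (clamp_lip a b y y').trans (le_max_right |Q - Q'| _)
    have h2 : 0 ≤ max |a| |b| * max |Q - Q'| |y - y'| := by positivity
    linarith

/-- The data of system (S) in polar coordinates. -/
structure PD where
  ω : ℝ
  c1 : ℝ
  c2 : ℝ
  α : ℝ
  K : ℝ
  A : ℝ → ℝ
  B : ℝ → ℝ
  D : ℝ → ℝ
  E : ℝ → ℝ
  H : ℝ → ℝ
  L : ℝ → ℝ
  P : ℝ → ℝ
  hω : ω ≠ 0
  hc1 : c1 ≠ 0
  hα : α ≠ 0
  hK : 0 < K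
  cA : Continuous A
  cB : Continuous B
  cD : Continuous D
  cE : Continuous E
  cH : Continuous H
  cL : Continuous L
  bA : ∀ θ, |A θ| ≤ K
  bB : ∀ θ, |B θ| ≤ K
  bD : ∀ θ, |D θ| ≤ K
  bE : ∀ θ, |E θ| ≤ K
  bH : ∀ θ, |H θ| ≤ K
  bL : ∀ θ, |L θ| ≤ K
  bP : ∀ θ, |P θ| ≤ K
  pA : ∀ θ, A (θ + 2 * π) = A θ
  pB : ∀ θ, B (θ + 2 * π) = B θ
  pD : ∀ θ, D (θ + 2 * π) = D θ
  pE : ∀ θ, E (θ + 2 * π) = E θ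
  pH : ∀ θ, H (θ + 2 * π) = H θ
  pL : ∀ θ, L (θ + 2 * π) = L θ
  pP : ∀ θ, P (θ + 2 * π) = P θ
  dP : ∀ θ, HasDerivAt P (A θ - α) θ

namespace PD
variable (d : PD)

/-- First-order part of the angular speed. -/
noncomputable def W (m θ Q y : ℝ) : ℝ := d.D θ * Q⁻¹ + m * (Q⁻¹ * Q⁻¹) * y * d.E θ
/-- Angular speed. -/
noncomputable def Om (m θ Q y : ℝ) : ℝ := d.ω + m * d.W m θ Q y
/-- Bracket in the `y` equation. -/
noncomputable def Br (m θ Q y : ℝ) : ℝ :=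
  m * d.c2 * (Q⁻¹ * Q⁻¹) * y + Q⁻¹ * d.L θ + 2 * d.α - 2 * Q⁻¹ * d.A θ
    - 2 * m * (Q⁻¹ * Q⁻¹) * y * d.B θ
/-- Right-hand side of the `Q` equation. -/
noncomputable def F1 (m θ Q y : ℝ) : ℝ :=
  m * (d.α * Q - d.A θ - m * Q⁻¹ * y * d.B θ) * (d.Om m θ Q y)⁻¹
/-- Right-hand side of the `y` equation. -/
noncomputable def F2 (m θ Q y : ℝ) : ℝ :=
  (d.c1 * y + d.H θ + m * y * d.Br m θ Q y) * (d.Om m θ Q y)⁻¹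
/-- Remainder of the `Q` equation. -/
noncomputable def R1 (m θ Q y : ℝ) : ℝ :=
  (-1) * ((d.α * Q - d.A θ - m * Q⁻¹ * y * d.B θ) * d.W m θ Q y * (d.Om m θ Q y)⁻¹ * d.ω⁻¹)
    - Q⁻¹ * y * d.B θ * d.ω⁻¹
/-- Remainder of the `y` equation. -/
noncomputable def R2 (m θ Q y : ℝ) : ℝ :=
  (-1) * ((d.c1 * y + d.H θ) * d.W m θ Q y * (d.Om m θ Q y)⁻¹ * d.ω⁻¹)
    + y * d.Br m θ Q y * (d.Om m θ Q y)⁻¹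

lemma F1_eq (m θ Q y : ℝ) (h : d.Om m θ Q y ≠ 0) :
    d.F1 m θ Q y = m * d.α / d.ω * Q + (-(m * d.A θ / d.ω) + m ^ 2 * d.R1 m θ Q y) := by
  have hO : d.Om m θ Q y = d.ω + m * d.W m θ Q y := rfl
  have hω := d.hω
  unfold F1 R1
  generalize d.Om m θ Q y = O at *
  generalize d.W m θ Q y = W at *
  have hW : m * W = O - d.ω := by linarith
  field_simp
  linear_combination (m * (d.α * Q - d.A θ - m * Q⁻¹ * y * d.B θ)) * hW

lemma F2_eq (m θ Q y : ℝ) (h : d.Om m θ Q y ≠ 0) :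
    d.F2 m θ Q y = d.c1 / d.ω * y + (d.H θ / d.ω + m * d.R2 m θ Q y) := by
  have hO : d.Om m θ Q y = d.ω + m * d.W m θ Q y := rfl
  have hω := d.hω
  unfold F2 R2
  generalize d.Om m θ Q y = O at *
  generalize d.W m θ Q y = W at *
  generalize d.Br m θ Q y = Br at *
  have hW : m * W = O - d.ω := by linarith
  field_simp
  linear_combination (d.c1 * y + d.H θ) * hW

lemma BL_W (Y : ℝ) (hY : 0 ≤ Y) :
    BL 1 (fun m θ Q y => d.W m θ (clamp (1/2) (3/2) Q) (clamp (-Y) Y y)) := by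
  have hQ : BL 1 (fun _ _ Q _ => clamp (1/2) (3/2) Q) := BL.clampQ (by norm_num)
  have hy : BL 1 (fun _ _ _ y => clamp (-Y) Y y) := BL.clampy (by linarith)
  have hQi : BL 1 (fun _ _ Q _ => (clamp (1/2) (3/2) Q)⁻¹) :=
    hQ.inv (c := 1/2) (by norm_num) fun m θ Q y _ =>
      (clamp_mem (by norm_num) Q).1.trans (le_abs_self _)
  have hD := BL.fn (m0 := 1) d.bD
  have hE := BL.fn (m0 := 1) d.bE
  have hm := BL.m (m0 := 1) zero_le_one
  exact (hD.mul hQi).add (((hm.mul (hQi.mul hQi)).mul hy).mul hE)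

lemma exists_m0 (Y : ℝ) (hY : 0 ≤ Y) : ∃ m0, 0 < m0 ∧ m0 ≤ 1 ∧ ∀ m θ Q y, |m| ≤ m0 →
    d.ω ^ 2 / 2 ≤ d.ω * d.Om m θ (clamp (1/2) (3/2) Q) (clamp (-Y) Y y) := by
  obtain ⟨K, hK, h⟩ := d.BL_W Y hY
  have hω := abs_pos.2 d.hω
  refine ⟨min 1 (|d.ω| / (2 * (K + 1))), by positivity, min_le_left _ _, fun m θ Q y hm => ?_⟩
  have h1 := (h m θ (hm.trans (min_le_left _ _))).1 Q y
  have h2 := hm.trans (min_le_right _ _)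
  rw [le_div_iff₀ (by positivity)] at h2
  unfold Om
  beta_reduce at h1
  generalize d.W m θ (clamp (1/2) (3/2) Q) (clamp (-Y) Y y) = W at *
  have h3 : |d.ω * (m * W)| ≤ d.ω ^ 2 / 2 := by
    rw [abs_mul, abs_mul, ← sq_abs d.ω]
    have : |m| * |W| ≤ |d.ω| / 2 := by
      have := mul_le_mul_of_nonneg_left h1 (abs_nonneg m)
      nlinarith [abs_nonneg m]
    nlinarith
  have := neg_abs_le (d.ω * (m * W))
  nlinarith

lemma Om_ne {m θ Q y : ℝ} (h : d.ω ^ 2 / 2 ≤ d.ω * d.Om m θ Q y) : d.Om m θ Q y ≠ 0 := by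
  intro h0
  rw [h0] at h
  have := pow_pos (abs_pos.2 d.hω) 2
  rw [sq_abs] at this
  linarith

lemma BL_R (Y m0 : ℝ) (hY : 0 ≤ Y) (h0 : 0 < m0) (h1 : m0 ≤ 1)
    (hO : ∀ m θ Q y, |m| ≤ m0 →
      d.ω ^ 2 / 2 ≤ d.ω * d.Om m θ (clamp (1/2) (3/2) Q) (clamp (-Y) Y y)) :
    BL m0 (fun m θ Q y => d.R1 m θ (clamp (1/2) (3/2) Q) (clamp (-Y) Y y)) ∧
    BL m0 (fun m θ Q y => d.R2 m θ (clamp (1/2) (3/2) Q) (clamp (-Y) Y y)) := by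
  have hQ : BL m0 (fun _ _ Q _ => clamp (1/2) (3/2) Q) := BL.clampQ (by norm_num)
  have hy : BL m0 (fun _ _ _ y => clamp (-Y) Y y) := BL.clampy (by linarith)
  have hQi : BL m0 (fun _ _ Q _ => (clamp (1/2) (3/2) Q)⁻¹) :=
    hQ.inv (c := 1/2) (by norm_num) fun m θ Q y _ =>
      (clamp_mem (by norm_num) Q).1.trans (le_abs_self _)
  have hA := BL.fn (m0 := m0) d.bA
  have hB := BL.fn (m0 := m0) d.bB
  have hH := BL.fn (m0 := m0) d.bH
  have hL := BL.fn (m0 := m0) d.bL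
  have hm := BL.m (m0 := m0) h0.le
  have hW := (d.BL_W Y hY).mono h1
  have hωpos := abs_pos.2 d.hω
  have hOm : BL m0 (fun m θ Q y => d.Om m θ (clamp (1/2) (3/2) Q) (clamp (-Y) Y y)) :=
    (BL.const d.ω).add (hm.mul hW)
  have hOi : BL m0 (fun m θ Q y => (d.Om m θ (clamp (1/2) (3/2) Q) (clamp (-Y) Y y))⁻¹) := by
    refine hOm.inv (c := |d.ω| / 2) (by positivity) fun m θ Q y hm => ?_
    have h2 := (hO m θ Q y hm).trans (le_abs_self _)
    rw [abs_mul, ← sq_abs] at h2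
    by_contra hcon
    push Not at hcon
    nlinarith
  have hBr : BL m0 (fun m θ Q y => d.Br m θ (clamp (1/2) (3/2) Q) (clamp (-Y) Y y)) :=
    ((((((hm.mul (BL.const d.c2)).mul (hQi.mul hQi)).mul hy).add (hQi.mul hL)).add
      ((BL.const 2).mul (BL.const d.α))).sub (((BL.const 2).mul hQi).mul hA)).sub
      (((((BL.const 2).mul hm).mul (hQi.mul hQi)).mul hy).mul hB)
  constructor
  · exact ((BL.const (-1)).mul (((((((BL.const d.α).mul hQ).sub hA).sub
      (((hm.mul hQi).mul hy).mul hB)).mul hW).mul hOi).mul (BL.const d.ω⁻¹))).sub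
      (((hQi.mul hy).mul hB).mul (BL.const d.ω⁻¹))
  · exact ((BL.const (-1)).mul (((((BL.const d.c1).mul hy).add hH).mul hW).mul hOi |>.mul
      (BL.const d.ω⁻¹))).add ((hy.mul hBr).mul hOi)

/-- The reduced system, analysed in the angular variable. -/
lemma theta_system (Y : ℝ) (hY : 2 * d.K / |d.c1| + 1 ≤ Y) : ∃ m0 C, 0 < m0 ∧ m0 ≤ 1 ∧ 0 < C ∧
    ∀ m, m ≠ 0 → |m| ≤ m0 →
    (∀ θ Q y, 1/2 ≤ Q → Q ≤ 3/2 → |y| ≤ Y → d.ω ^ 2 / 2 ≤ d.ω * d.Om m θ Q y) ∧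
    (∃ Q y : ℝ → ℝ, (∀ θ, Q (θ + 2 * π) = Q θ) ∧ (∀ θ, y (θ + 2 * π) = y θ) ∧
      (∀ θ, HasDerivAt Q (d.F1 m θ (Q θ) (y θ)) θ) ∧
      (∀ θ, HasDerivAt y (d.F2 m θ (Q θ) (y θ)) θ) ∧
      (∀ θ, |Q θ - 1| ≤ C * |m|) ∧ (∀ θ, |Q θ - 1| ≤ 1 / 2) ∧ (∀ θ, |y θ| ≤ Y)) ∧
    (∀ (Q₁ y₁ Q₂ y₂ : ℝ → ℝ),
      (∃ T > 0, (∀ θ, Q₁ (θ + T) = Q₁ θ) ∧ (∀ θ, y₁ (θ + T) = y₁ θ) ∧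
        (∀ θ, Q₂ (θ + T) = Q₂ θ) ∧ (∀ θ, y₂ (θ + T) = y₂ θ)) →
      (∀ θ, HasDerivAt Q₁ (d.F1 m θ (Q₁ θ) (y₁ θ)) θ) →
      (∀ θ, HasDerivAt y₁ (d.F2 m θ (Q₁ θ) (y₁ θ)) θ) →
      (∀ θ, HasDerivAt Q₂ (d.F1 m θ (Q₂ θ) (y₂ θ)) θ) →
      (∀ θ, HasDerivAt y₂ (d.F2 m θ (Q₂ θ) (y₂ θ)) θ) →
      (∀ θ, |Q₁ θ - 1| ≤ 1 / 2) → (∀ θ, |y₁ θ| ≤ Y) →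
      (∀ θ, |Q₂ θ - 1| ≤ 1 / 2) → (∀ θ, |y₂ θ| ≤ Y) → Q₁ = Q₂ ∧ y₁ = y₂) := by
  have hωpos := abs_pos.2 d.hω
  have hαpos := abs_pos.2 d.hα
  have hc1pos := abs_pos.2 d.hc1
  have hKpos := d.hK
  have hY0 : 0 ≤ Y := le_trans (by positivity) hY
  obtain ⟨n0, hn0, hn1, hO⟩ := d.exists_m0 Y hY0
  obtain ⟨⟨K1, hK1, hR1⟩, ⟨K2, hK2, hR2⟩⟩ := d.BL_R Y n0 hY0 hn0 hn1 hO
  -- constants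
  set C : ℝ := K1 * |d.ω| / |d.α| + d.K / |d.ω| + (d.K * 1 / |d.ω|) + 1 with hC
  have hCpos : 0 < C := by positivity
  refine ⟨min n0 (min (|d.α| / (2 * |d.ω| * (K1 + 1))) (min (|d.c1| / (2 * |d.ω| * (K2 + 1)))
    (1 / (2 * C)))), C, by positivity, (min_le_left _ _).trans hn1, hCpos, ?_⟩
  intro m hm0 hm
  have hmpos := abs_pos.2 hm0
  have m1 : |m| ≤ n0 := hm.trans (min_le_left _ _)
  have m2 : |m| ≤ |d.α| / (2 * |d.ω| * (K1 + 1)) :=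
    hm.trans ((min_le_right _ _).trans (min_le_left _ _))
  have m3 : |m| ≤ |d.c1| / (2 * |d.ω| * (K2 + 1)) :=
    hm.trans ((min_le_right _ _).trans ((min_le_right _ _).trans (min_le_left _ _)))
  have m4 : |m| ≤ 1 / (2 * C) :=
    hm.trans ((min_le_right _ _).trans ((min_le_right _ _).trans (min_le_right _ _)))
  rw [le_div_iff₀ (by positivity)] at m2 m3 m4
  have hl1 : m * d.α / d.ω ≠ 0 := div_ne_zero (mul_ne_zero hm0 d.hα) d.hω
  have hl2 : d.c1 / d.ω ≠ 0 := div_ne_zero d.hc1 d.hω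
  have lip1 : m ^ 2 * K1 ≤ |m * d.α / d.ω| / 2 := by
    rw [abs_div, abs_mul, ← sq_abs, div_div, le_div_iff₀ (by positivity)]
    have h1 : |m| * (2 * |d.ω| * K1) ≤ |d.α| := by nlinarith [mul_pos hmpos hωpos]
    nlinarith
  have lip2 : |m| * K2 ≤ |d.c1 / d.ω| / 2 := by
    rw [abs_div, div_div, le_div_iff₀ (by positivity)]
    nlinarith [mul_pos hmpos hωpos]
  let q := fun Q => clamp (1/2) (3/2) Q
  let z := fun y => clamp (-Y) Y y
  have hq : ∀ Q, |Q - 1| ≤ 1/2 → q Q = Q := by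
    intro Q h
    rw [abs_le] at h
    exact clamp_eq (by linarith) (by linarith)
  have hz : ∀ y, |y| ≤ Y → z y = y := by
    intro y h
    rw [abs_le] at h
    exact clamp_eq (by linarith) (by linarith)
  have hOm : ∀ θ Q y, |Q - 1| ≤ 1/2 → |y| ≤ Y → d.ω ^ 2 / 2 ≤ d.ω * d.Om m θ Q y := by
    intro θ Q y h1 h2
    have := hO m θ Q y m1
    change d.ω ^ 2 / 2 ≤ d.ω * d.Om m θ (q Q) (z y) at this
    rwa [hq Q h1, hz y h2] at this
  -- modified right-hand sides
  let g1 : ℝ → ℝ → ℝ → ℝ := fun θ Q y => -(m * d.A θ / d.ω) + m ^ 2 * d.R1 m θ (q Q) (z y)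
  let g2 : ℝ → ℝ → ℝ → ℝ := fun θ Q y => d.H θ / d.ω + m * d.R2 m θ (q Q) (z y)
  have hF1 : ∀ θ Q y, |Q - 1| ≤ 1/2 → |y| ≤ Y →
      d.F1 m θ Q y = m * d.α / d.ω * Q + g1 θ Q y := by
    intro θ Q y h1 h2
    rw [d.F1_eq m θ Q y (d.Om_ne (hOm θ Q y h1 h2))]
    simp only [g1, hq Q h1, hz y h2]
  have hF2 : ∀ θ Q y, |Q - 1| ≤ 1/2 → |y| ≤ Y →
      d.F2 m θ Q y = d.c1 / d.ω * y + g2 θ Q y := by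
    intro θ Q y h1 h2
    rw [d.F2_eq m θ Q y (d.Om_ne (hOm θ Q y h1 h2))]
    simp only [g2, hq Q h1, hz y h2]
  have hL1 : ∀ θ Q y Q' y', |g1 θ Q y - g1 θ Q' y'| ≤
      |m * d.α / d.ω| / 2 * max |Q - Q'| |y - y'| := by
    intro θ Q y Q' y'
    have h1 := (hR1 m θ m1).2 Q y Q' y'
    have e : g1 θ Q y - g1 θ Q' y' = m ^ 2 * (d.R1 m θ (q Q) (z y) - d.R1 m θ (q Q') (z y')) := by
      simp only [g1]; ring
    rw [e, abs_mul, abs_of_nonneg (sq_nonneg m)]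
    have hM : 0 ≤ max |Q - Q'| |y - y'| := le_max_of_le_left (abs_nonneg _)
    calc m ^ 2 * |d.R1 m θ (q Q) (z y) - d.R1 m θ (q Q') (z y')|
        ≤ m ^ 2 * (K1 * max |Q - Q'| |y - y'|) := mul_le_mul_of_nonneg_left h1 (sq_nonneg m)
      _ = m ^ 2 * K1 * max |Q - Q'| |y - y'| := by ring
      _ ≤ _ := mul_le_mul_of_nonneg_right lip1 hM
  have hL2 : ∀ θ Q y Q' y', |g2 θ Q y - g2 θ Q' y'| ≤
      |d.c1 / d.ω| / 2 * max |Q - Q'| |y - y'| := by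
    intro θ Q y Q' y'
    have h1 := (hR2 m θ m1).2 Q y Q' y'
    have e : g2 θ Q y - g2 θ Q' y' = m * (d.R2 m θ (q Q) (z y) - d.R2 m θ (q Q') (z y')) := by
      simp only [g2]; ring
    rw [e, abs_mul]
    have hM : 0 ≤ max |Q - Q'| |y - y'| := le_max_of_le_left (abs_nonneg _)
    calc |m| * |d.R2 m θ (q Q) (z y) - d.R2 m θ (q Q') (z y')|
        ≤ |m| * (K2 * max |Q - Q'| |y - y'|) := mul_le_mul_of_nonneg_left h1 (abs_nonneg m)
      _ = |m| * K2 * max |Q - Q'| |y - y'| := by ring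
      _ ≤ _ := mul_le_mul_of_nonneg_right lip2 hM
  refine ⟨?_, ?_, ?_⟩
  · intro θ Q y h1 h2 h3
    exact hOm θ Q y (abs_le.2 ⟨by linarith, by linarith⟩) h3
  · have hcq : Continuous q := clamp_continuous _ _
    have hcz : Continuous z := clamp_continuous _ _
    have hqi : Continuous fun Q => (q Q)⁻¹ := hcq.inv₀ fun Q => by
      have := (clamp_mem (by norm_num : (1/2:ℝ) ≤ 3/2) Q).1
      intro h0
      change 1/2 ≤ q Q at this
      rw [h0] at this
      norm_num at this
    have hcW : Continuous fun p : ℝ × ℝ × ℝ => d.W m p.1 (q p.2.1) (z p.2.2) := by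
      have := d.cD
      have := d.cE
      have hqi' : Continuous fun p : ℝ × ℝ × ℝ => (q p.2.1)⁻¹ := hqi.comp (by fun_prop)
      unfold W
      fun_prop
    have hcO : Continuous fun p : ℝ × ℝ × ℝ => (d.Om m p.1 (q p.2.1) (z p.2.2))⁻¹ := by
      refine Continuous.inv₀ ?_ fun p => d.Om_ne (hO m _ _ _ m1)
      unfold Om
      fun_prop
    have hcB : Continuous fun p : ℝ × ℝ × ℝ => d.Br m p.1 (q p.2.1) (z p.2.2) := by
      have := d.cL
      have := d.cA
      have := d.cB
      have hqi' : Continuous fun p : ℝ × ℝ × ℝ => (q p.2.1)⁻¹ := hqi.comp (by fun_prop)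
      unfold Br
      fun_prop
    have hcg1 : Continuous fun p : ℝ × ℝ × ℝ => g1 p.1 p.2.1 p.2.2 := by
      have := d.cA
      have := d.cB
      have hqi' : Continuous fun p : ℝ × ℝ × ℝ => (q p.2.1)⁻¹ := hqi.comp (by fun_prop)
      simp only [g1, R1]
      fun_prop
    have hcg2 : Continuous fun p : ℝ × ℝ × ℝ => g2 p.1 p.2.1 p.2.2 := by
      have := d.cH
      simp only [g2, R2]
      fun_prop
    have hb1 : ∀ θ Q y, |g1 θ Q y + m * d.A θ / d.ω| ≤ m ^ 2 * K1 := by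
      intro θ Q y
      have e : g1 θ Q y + m * d.A θ / d.ω = m ^ 2 * d.R1 m θ (q Q) (z y) := by
        simp only [g1]; ring
      rw [e, abs_mul, abs_of_nonneg (sq_nonneg m)]
      exact mul_le_mul_of_nonneg_left ((hR1 m θ m1).1 Q y) (sq_nonneg m)
    have hb2 : ∀ θ Q y, |g2 θ Q y| ≤ d.K / |d.ω| + |m| * K2 := by
      intro θ Q y
      refine (abs_add_le _ _).trans (add_le_add ?_ ?_)
      · rw [abs_div]
        exact div_le_div_of_nonneg_right (d.bH θ) hωpos.le
      · rw [abs_mul]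
        exact mul_le_mul_of_nonneg_left ((hR2 m θ m1).1 Q y) (abs_nonneg m)
    have hb1' : ∀ θ Q y, |g1 θ Q y| ≤ m ^ 2 * K1 + |m| * d.K / |d.ω| := by
      intro θ Q y
      have e : g1 θ Q y = (g1 θ Q y + m * d.A θ / d.ω) + (-(m * d.A θ / d.ω)) := by ring
      rw [e]
      refine (abs_add_le _ _).trans (add_le_add (hb1 θ Q y) ?_)
      rw [abs_neg, abs_div, abs_mul]
      exact div_le_div_of_nonneg_right
        (mul_le_mul_of_nonneg_left (d.bA θ) (abs_nonneg m)) hωpos.le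
    obtain ⟨Q, y, pQ, py, dQ, dy⟩ := exists_periodic hl1 hl2 hcg1 hcg2
      (K := max (m ^ 2 * K1 + |m| * d.K / |d.ω|) (d.K / |d.ω| + |m| * K2))
      (fun θ Q y => (hb1' θ Q y).trans (le_max_left _ _))
      (fun θ Q y => (hb2 θ Q y).trans (le_max_right _ _)) hL1 hL2
      (fun θ Q y => by simp only [g1, R1, Om, W, d.pA, d.pB, d.pD, d.pE])
      (fun θ Q y => by simp only [g2, R2, Om, W, Br, d.pA, d.pB, d.pD, d.pE, d.pH, d.pL])
    have hpi : 0 < 2 * π := by positivity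
    have hyb : ∀ θ, |y θ| ≤ Y := by
      intro θ
      have := max_principle (l := d.c1 / d.ω) (K := d.K / |d.ω| + |m| * K2) (M := 0) hpi py dy (abs_nonneg _)
        (fun t => by simpa using hb2 t (Q t) (y t)) θ
      rw [sub_zero] at this
      have hx : |m| * K2 ≤ |d.c1| / |d.ω| / 2 := by rw [← abs_div]; exact lip2
      rw [abs_div] at this
      have h3 : |d.c1| / |d.ω| * |y θ| ≤ |d.c1| / |d.ω| * Y := by
        refine (this.trans (add_le_add_right hx _)).trans ?_
        refine le_trans ?_ (mul_le_mul_of_nonneg_left hY (by positivity))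
        rw [mul_add]
        have e : |d.c1| / |d.ω| * (2 * d.K / |d.c1|) = 2 * (d.K / |d.ω|) := by field_simp
        rw [e]
        have : 0 < d.K / |d.ω| := by positivity
        have : 0 < |d.c1| / |d.ω| := by positivity
        linarith
      exact le_of_mul_le_mul_left h3 (by positivity)
    have hQb : ∀ θ, |Q θ - 1| ≤ C * |m| := by
      intro θ
      have hd : ∀ t, HasDerivAt (fun t => Q t - 1 + m / d.ω * d.P t)
          (m * d.α / d.ω * Q t + g1 t (Q t) (y t) + m / d.ω * (d.A t - d.α)) t := fun t =>
        ((dQ t).sub_const 1).add ((d.dP t).const_mul (m / d.ω))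
      have := max_principle (l := m * d.α / d.ω) (M := 0)
        (K := m ^ 2 * K1 + |m * d.α / d.ω| * (|m / d.ω| * d.K)) hpi
        (fun t => by simp only [pQ, d.pP]) hd (abs_nonneg _) (fun t => by
          have e : m * d.α / d.ω * Q t + g1 t (Q t) (y t) + m / d.ω * (d.A t - d.α) -
            m * d.α / d.ω * (Q t - 1 + m / d.ω * d.P t) =
            (g1 t (Q t) (y t) + m * d.A t / d.ω) - m * d.α / d.ω * (m / d.ω * d.P t) := by ring
          rw [e, zero_mul, add_zero]
          refine (abs_sub _ _).trans (add_le_add (hb1 _ _ _) ?_)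
          rw [abs_mul, abs_mul (m / d.ω)]
          exact mul_le_mul_of_nonneg_left (mul_le_mul_of_nonneg_left (d.bP t) (abs_nonneg _))
            (abs_nonneg _)) θ
      rw [sub_zero] at this
      have h4 : |Q θ - 1 + m / d.ω * d.P θ| ≤ |m| * (K1 * |d.ω| / |d.α|) + |m| * (d.K / |d.ω|) := by
        refine le_of_mul_le_mul_left (this.trans (le_of_eq ?_)) (abs_pos.2 hl1)
        rw [abs_div, abs_div, abs_mul, ← sq_abs]
        field_simp
      have h5 : |m / d.ω * d.P θ| ≤ |m| * (d.K / |d.ω|) := by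
        rw [abs_mul, abs_div]
        refine (mul_le_mul_of_nonneg_left (d.bP θ) (by positivity)).trans (le_of_eq ?_)
        ring
      have h6 := abs_sub (Q θ - 1 + m / d.ω * d.P θ) (m / d.ω * d.P θ)
      rw [add_sub_cancel_right] at h6
      refine (h6.trans (add_le_add h4 h5)).trans ?_
      rw [hC]
      have e7 : (d.K * 1 / |d.ω|) = d.K / |d.ω| := by rw [mul_one]
      rw [e7]
      nlinarith
    have hQb' : ∀ θ, |Q θ - 1| ≤ 1 / 2 := fun θ => (hQb θ).trans (by linarith)
    exact ⟨Q, y, pQ, py, fun θ => by rw [hF1 _ _ _ (hQb' θ) (hyb θ)]; exact dQ θ,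
      fun θ => by rw [hF2 _ _ _ (hQb' θ) (hyb θ)]; exact dy θ, hQb, hQb', hyb⟩
  · intro Q₁ y₁ Q₂ y₂ hper dQ1 dy1 dQ2 dy2 bQ1 by1 bQ2 by2
    obtain ⟨T, hT, pQ1, py1, pQ2, py2⟩ := hper
    have dQ : ∀ θ, HasDerivAt (fun θ => Q₁ θ - Q₂ θ)
        (d.F1 m θ (Q₁ θ) (y₁ θ) - d.F1 m θ (Q₂ θ) (y₂ θ)) θ := fun θ => (dQ1 θ).sub (dQ2 θ)
    have dy : ∀ θ, HasDerivAt (fun θ => y₁ θ - y₂ θ)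
        (d.F2 m θ (Q₁ θ) (y₁ θ) - d.F2 m θ (Q₂ θ) (y₂ θ)) θ := fun θ => (dy1 θ).sub (dy2 θ)
    obtain ⟨s, hs0, hs⟩ := exists_crit_max hT (fun θ => by simp only [pQ1, pQ2]) dQ
    obtain ⟨t, ht0, ht⟩ := exists_crit_max hT (fun θ => by simp only [py1, py2]) dy
    set M := max |Q₁ s - Q₂ s| |y₁ t - y₂ t| with hM
    have hbd : ∀ θ, max |Q₁ θ - Q₂ θ| |y₁ θ - y₂ θ| ≤ M := fun θ => max_le_max (hs θ) (ht θ)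
    have k1 : |Q₁ s - Q₂ s| ≤ M / 2 := by
      rw [hF1 _ _ _ (bQ1 s) (by1 s), hF1 _ _ _ (bQ2 s) (by2 s)] at hs0
      have h1 := (hL1 s (Q₁ s) (y₁ s) (Q₂ s) (y₂ s)).trans
        (mul_le_mul_of_nonneg_left (hbd s) (by positivity))
      have e : g1 s (Q₁ s) (y₁ s) - g1 s (Q₂ s) (y₂ s) = -(m * d.α / d.ω * (Q₁ s - Q₂ s)) := by
        linarith
      rw [e, abs_neg, abs_mul] at h1
      refine le_of_mul_le_mul_left (h1.trans (le_of_eq ?_)) (abs_pos.2 hl1)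
      ring
    have k2 : |y₁ t - y₂ t| ≤ M / 2 := by
      rw [hF2 _ _ _ (bQ1 t) (by1 t), hF2 _ _ _ (bQ2 t) (by2 t)] at ht0
      have h1 := (hL2 t (Q₁ t) (y₁ t) (Q₂ t) (y₂ t)).trans
        (mul_le_mul_of_nonneg_left (hbd t) (by positivity))
      have e : g2 t (Q₁ t) (y₁ t) - g2 t (Q₂ t) (y₂ t) = -(d.c1 / d.ω * (y₁ t - y₂ t)) := by
        linarith
      rw [e, abs_neg, abs_mul] at h1
      refine le_of_mul_le_mul_left (h1.trans (le_of_eq ?_)) (abs_pos.2 hl2)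
      ring
    have hM0 : M ≤ 0 := by
      have := max_le k1 k2
      rw [← hM] at this
      linarith
    constructor
    · funext θ
      have := ((le_max_left _ _).trans (hbd θ)).trans hM0
      exact sub_eq_zero.1 (abs_eq_zero.1 (le_antisymm this (abs_nonneg _)))
    · funext θ
      have := ((le_max_right _ _).trans (hbd θ)).trans hM0
      exact sub_eq_zero.1 (abs_eq_zero.1 (le_antisymm this (abs_nonneg _)))

end PD

lemma zero_of_bound {N N' : ℝ → ℝ} {k t0 : ℝ} (hd : ∀ t, HasDerivAt N (N' t) t)
    (hN : ∀ t, 0 ≤ N t) (hb : ∀ t, |N' t| ≤ k * N t) (h0 : N t0 = 0) (t : ℝ) : N t = 0 := by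
  have he : ∀ c t : ℝ, HasDerivAt (fun t => exp (c * t)) (exp (c * t) * (c * 1)) t := fun c t =>
    ((hasDerivAt_id t).const_mul c).exp
  rcases le_total t t0 with h | h
  · have hm : Monotone fun t => N t * exp (k * t) := by
      have hd' := fun t => (hd t).fun_mul (he k t)
      refine monotone_of_deriv_nonneg (fun t => (hd' t).differentiableAt) fun t => ?_
      rw [(hd' t).deriv]
      have := neg_abs_le (N' t)
      have h1 : 0 ≤ (N' t + k * N t) * exp (k * t) :=
        mul_nonneg (by linarith [hb t]) (exp_pos _).le
      linarith
    have := hm h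
    simp only [h0, zero_mul] at this
    exact le_antisymm (nonpos_of_mul_nonpos_left this (exp_pos _)) (hN t)
  · have hm : Antitone fun t => N t * exp (-k * t) := by
      have hd' := fun t => (hd t).fun_mul (he (-k) t)
      refine antitone_of_deriv_nonpos (fun t => (hd' t).differentiableAt) fun t => ?_
      rw [(hd' t).deriv]
      have := le_abs_self (N' t)
      have h1 : 0 ≤ (k * N t - N' t) * exp (-k * t) :=
        mul_nonneg (by linarith [hb t]) (exp_pos _).le
      linarith
    have := hm h
    simp only [h0, zero_mul] at this
    exact le_antisymm (nonpos_of_mul_nonpos_left this (exp_pos _)) (hN t)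

lemma polar_exists (v w : ℝ) : ∃ φ, v = √(v ^ 2 + w ^ 2) * cos φ ∧ w = √(v ^ 2 + w ^ 2) * sin φ := by
  refine ⟨Complex.arg ⟨v, w⟩, ?_, ?_⟩
  · have := Complex.norm_mul_cos_arg ⟨v, w⟩
    rw [Complex.norm_eq_sqrt_sq_add_sq] at this
    exact this.symm
  · have := Complex.norm_mul_sin_arg ⟨v, w⟩
    rw [Complex.norm_eq_sqrt_sq_add_sq] at this
    exact this.symm

lemma const_of_hasDerivAt_zero {f : ℝ → ℝ} (h : ∀ t, HasDerivAt f 0 t) (s t : ℝ) : f s = f t :=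
  is_const_of_deriv_eq_zero (fun t => (h t).differentiableAt) (fun t => (h t).deriv) s t

lemma polar_lift {v w a Ω : ℝ → ℝ} (hΩ : Continuous Ω) (hpos : ∀ t, 0 < v t ^ 2 + w t ^ 2)
    (hv : ∀ t, HasDerivAt v (a t * v t - Ω t * w t) t)
    (hw : ∀ t, HasDerivAt w (a t * w t + Ω t * v t) t) :
    ∃ θ : ℝ → ℝ, (∀ t, HasDerivAt θ (Ω t) t) ∧
      (∀ t, HasDerivAt (fun t => √(v t ^ 2 + w t ^ 2)) (a t * √(v t ^ 2 + w t ^ 2)) t) ∧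
      (∀ t, v t = √(v t ^ 2 + w t ^ 2) * cos (θ t)) ∧
      (∀ t, w t = √(v t ^ 2 + w t ^ 2) * sin (θ t)) := by
  obtain ⟨φ, hφ1, hφ2⟩ := polar_exists (v 0) (w 0)
  let θ : ℝ → ℝ := fun t => φ + ∫ s in (0:ℝ)..t, Ω s
  have hθ : ∀ t, HasDerivAt θ (Ω t) t := fun t =>
    (intervalIntegral.integral_hasDerivAt_right (hΩ.intervalIntegrable _ _)
      hΩ.aestronglyMeasurable.stronglyMeasurableAtFilter hΩ.continuousAt).const_add φ
  have hθ0 : θ 0 = φ := by simp [θ]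
  let r : ℝ → ℝ := fun t => √(v t ^ 2 + w t ^ 2)
  have hrpos : ∀ t, 0 < r t := fun t => Real.sqrt_pos.2 (hpos t)
  have hrsq : ∀ t, r t ^ 2 = v t ^ 2 + w t ^ 2 := fun t => Real.sq_sqrt (hpos t).le
  have hr : ∀ t, HasDerivAt r (a t * r t) t := by
    intro t
    have h1 := (((hv t).pow 2).add ((hw t).pow 2)).sqrt (hpos t).ne'
    refine h1.congr_deriv ?_
    have h2 := hrsq t
    have h3 := (hrpos t).ne'
    change _ / (2 * r t) = _
    simp only [Nat.cast_ofNat, Nat.add_one_sub_one, pow_one]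
    field_simp
    rw [h2]
    ring
  let p : ℝ → ℝ := fun t => (v t * cos (θ t) + w t * sin (θ t)) / r t
  let k : ℝ → ℝ := fun t => (w t * cos (θ t) - v t * sin (θ t)) / r t
  have hp : ∀ t, HasDerivAt p 0 t := by
    intro t
    have h1 := ((((hv t).mul (hθ t).cos).add ((hw t).mul (hθ t).sin)).div (hr t) (hrpos t).ne')
    refine h1.congr_deriv ?_
    have h3 := (hrpos t).ne'
    simp only [Pi.add_apply, Pi.mul_apply]
    field_simp
    ring
  have hk : ∀ t, HasDerivAt k 0 t := by
    intro t
    have h1 := ((((hw t).mul (hθ t).cos).sub ((hv t).mul (hθ t).sin)).div (hr t) (hrpos t).ne')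
    refine h1.congr_deriv ?_
    have h3 := (hrpos t).ne'
    simp only [Pi.sub_apply, Pi.mul_apply]
    field_simp
    ring
  have hp1 : ∀ t, v t * cos (θ t) + w t * sin (θ t) = r t := by
    intro t
    have h1 := const_of_hasDerivAt_zero hp t 0
    have h2 : p 0 = 1 := by
      show (v 0 * cos (θ 0) + w 0 * sin (θ 0)) / r 0 = 1
      rw [div_eq_one_iff_eq (hrpos 0).ne', hθ0]
      change v 0 = r 0 * cos φ at hφ1
      change w 0 = r 0 * sin φ at hφ2
      rw [hφ1, hφ2]
      linear_combination (r 0) * (Real.sin_sq_add_cos_sq φ)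
    rw [h2] at h1
    exact (div_eq_one_iff_eq (hrpos t).ne').1 h1
  have hk1 : ∀ t, w t * cos (θ t) - v t * sin (θ t) = 0 := by
    intro t
    have h1 := const_of_hasDerivAt_zero hk t 0
    have h2 : k 0 = 0 := by
      show (w 0 * cos (θ 0) - v 0 * sin (θ 0)) / r 0 = 0
      rw [hθ0]
      change v 0 = r 0 * cos φ at hφ1
      change w 0 = r 0 * sin φ at hφ2
      rw [hφ1, hφ2]
      ring
    rw [h2] at h1
    exact (div_eq_zero_iff.1 h1).resolve_right (hrpos t).ne'
  refine ⟨θ, hθ, hr, fun t => ?_, fun t => ?_⟩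
  · change v t = r t * cos (θ t)
    rw [← hp1]
    linear_combination (-v t) * (Real.sin_sq_add_cos_sq (θ t)) - sin (θ t) * hk1 t
  · change w t = r t * sin (θ t)
    rw [← hp1]
    linear_combination (-w t) * (Real.sin_sq_add_cos_sq (θ t)) + cos (θ t) * hk1 t

namespace PD
variable (d : PD)

/-- `F` is the vector field whose polar data are `d`. -/
def IsField (F : ℝ → ℝ × ℝ × ℝ → ℝ × ℝ × ℝ) : Prop :=
  (∀ μ, Continuous (F μ)) ∧ ∀ μ u r θ, 0 ≤ r → F μ (u, r * cos θ, r * sin θ) =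
    (d.c1 * u + d.c2 * u ^ 2 + u * r * d.L θ + r ^ 2 * d.H θ,
     (μ + r * d.A θ + u * d.B θ) * (r * cos θ) - (d.ω + r * d.D θ + u * d.E θ) * (r * sin θ),
     (μ + r * d.A θ + u * d.B θ) * (r * sin θ) + (d.ω + r * d.D θ + u * d.E θ) * (r * cos θ))

variable {d} {F : ℝ → ℝ × ℝ × ℝ → ℝ × ℝ × ℝ}

lemma comps_lt {x : ℝ × ℝ × ℝ} {δ : ℝ} (h : ‖x‖ < δ) :
    |x.1| < δ ∧ √(x.2.1 ^ 2 + x.2.2 ^ 2) < 2 * δ := by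
  have h1 : |x.1| ≤ ‖x‖ := norm_fst_le x
  have h2 : |x.2.1| ≤ ‖x‖ := (norm_fst_le x.2).trans (norm_snd_le x)
  have h3 : |x.2.2| ≤ ‖x‖ := (norm_snd_le x.2).trans (norm_snd_le x)
  have hδ : 0 < δ := (norm_nonneg x).trans_lt h
  refine ⟨h1.trans_lt h, ?_⟩
  rw [Real.sqrt_lt' (by linarith)]
  have e1 : x.2.1 ^ 2 ≤ δ ^ 2 := sq_le_sq' (by linarith [neg_abs_le x.2.1]) (by linarith [le_abs_self x.2.1])
  have e2 : x.2.2 ^ 2 ≤ δ ^ 2 := sq_le_sq' (by linarith [neg_abs_le x.2.2]) (by linarith [le_abs_self x.2.2])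
  nlinarith

lemma bound_three {a b K u r δ : ℝ} (ha : |a| ≤ K) (hb : |b| ≤ K) (hr0 : 0 ≤ r)
    (hr : r < 2 * δ) (hu : |u| < δ) : |r * a + u * b| ≤ 3 * K * δ := by
  have hK : 0 ≤ K := (abs_nonneg a).trans ha
  refine (abs_add_le _ _).trans ?_
  rw [abs_mul, abs_mul, abs_of_nonneg hr0]
  have h1 := mul_le_mul hr.le ha (abs_nonneg a) (by linarith)
  have h2 := mul_le_mul hu.le hb (abs_nonneg b) (by linarith [abs_nonneg u])
  linarith

lemma nonvanishing (hF : d.IsField F) {μ δ : ℝ} {x : ℝ → ℝ × ℝ × ℝ}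
    (hx : IsPeriodicSolution3 (F μ) x) (hδ : ∀ t, ‖x t‖ < δ) (h1 : |d.c2| * δ ≤ |d.c1| / 2)
    (t : ℝ) : 0 < (x t).2.1 ^ 2 + (x t).2.2 ^ 2 := by
  obtain ⟨hsol, ⟨T, hT, hper⟩, hnc⟩ := hx
  have hd1 : ∀ t, HasDerivAt (fun t => (x t).1) (F μ (x t)).1 t := fun t => (hsol t).fst
  have hd2 : ∀ t, HasDerivAt (fun t => (x t).2.1) (F μ (x t)).2.1 t := fun t => (hsol t).snd.fst
  have hd3 : ∀ t, HasDerivAt (fun t => (x t).2.2) (F μ (x t)).2.2 t := fun t => (hsol t).snd.snd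
  by_contra hcon
  have h0 : (x t).2.1 ^ 2 + (x t).2.2 ^ 2 = 0 :=
    le_antisymm (not_lt.1 hcon) (by positivity)
  have hN := fun t => ((hd2 t).pow 2).add ((hd3 t).pow 2)
  have hz := zero_of_bound (k := 2 * (|μ| + 3 * d.K * δ)) hN
    (fun t => by simp only [Pi.add_apply, Pi.pow_apply]; positivity) (fun t => by
      obtain ⟨φ, e1, e2⟩ := polar_exists (x t).2.1 (x t).2.2
      obtain ⟨b1, b2⟩ := comps_lt (hδ t)
      have hr0 := Real.sqrt_nonneg ((x t).2.1 ^ 2 + (x t).2.2 ^ 2)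
      have hr2 : √((x t).2.1 ^ 2 + (x t).2.2 ^ 2) ^ 2 = (x t).2.1 ^ 2 + (x t).2.2 ^ 2 :=
        Real.sq_sqrt (by positivity)
      have hfx := hF.2 μ (x t).1 _ φ hr0
      rw [← e1, ← e2] at hfx
      have hfx' : F μ (x t) = _ := hfx
      rw [hfx']
      simp only [Pi.add_apply, Pi.pow_apply, Nat.cast_ofNat, Nat.add_one_sub_one, pow_one]
      have hbd := bound_three (d.bA φ) (d.bB φ) hr0 b2 b1
      set r := √((x t).2.1 ^ 2 + (x t).2.2 ^ 2)
      have e : 2 * (x t).2.1 * ((μ + r * d.A φ + (x t).1 * d.B φ) * (x t).2.1 -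
          (d.ω + r * d.D φ + (x t).1 * d.E φ) * (x t).2.2) +
          2 * (x t).2.2 * ((μ + r * d.A φ + (x t).1 * d.B φ) * (x t).2.2 +
          (d.ω + r * d.D φ + (x t).1 * d.E φ) * (x t).2.1) =
          2 * ((x t).2.1 ^ 2 + (x t).2.2 ^ 2) * (μ + (r * d.A φ + (x t).1 * d.B φ)) := by ring
      rw [e, abs_mul, abs_of_nonneg (by positivity)]
      have := (abs_add_le μ (r * d.A φ + (x t).1 * d.B φ)).trans (add_le_add_right hbd |μ|)
      have hpos : 0 ≤ (x t).2.1 ^ 2 + (x t).2.2 ^ 2 := by positivity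
      nlinarith) (t0 := t) h0
  have hv : ∀ t, (x t).2.1 = 0 := fun t => by
    have := hz t
    simp only [Pi.add_apply, Pi.pow_apply] at this
    nlinarith [sq_nonneg (x t).2.1, sq_nonneg (x t).2.2]
  have hw : ∀ t, (x t).2.2 = 0 := fun t => by
    have := hz t
    simp only [Pi.add_apply, Pi.pow_apply] at this
    nlinarith [sq_nonneg (x t).2.1, sq_nonneg (x t).2.2]
  have hfu : ∀ t, (F μ (x t)).1 = d.c1 * (x t).1 + d.c2 * (x t).1 ^ 2 := by
    intro t
    have hxt : x t = ((x t).1, 0 * cos 0, 0 * sin 0) := by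
      ext <;> simp [hv, hw]
    rw [hxt, hF.2 μ _ 0 0 le_rfl]
    simp
  have hu : ∀ t, (x t).1 = 0 := by
    intro t
    have := max_principle (l := d.c1) (K := 0) (M := |d.c1| / 2) hT
      (fun t => by simp only [hper]) hd1 (by linarith [abs_nonneg d.c1]) (fun t => by
        rw [hfu t, add_sub_cancel_left, zero_add, abs_mul, pow_two, abs_mul, ← mul_assoc]
        refine mul_le_mul_of_nonneg_right (le_trans ?_ h1) (abs_nonneg _)
        exact mul_le_mul_of_nonneg_left (comps_lt (hδ t)).1.le (abs_nonneg _)) t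
    have h2 := abs_pos.2 d.hc1
    have : |(x t).1| ≤ 0 := by
      by_contra hc
      push Not at hc
      nlinarith
    exact abs_eq_zero.1 (le_antisymm this (abs_nonneg _))
  exact hnc fun t => by
    ext
    · rw [hu, hu]
    · rw [hv, hv]
    · rw [hw, hw]

/-- Polar coordinates along a small periodic solution. -/
lemma to_polar (hF : d.IsField F) {μ δ : ℝ} {x : ℝ → ℝ × ℝ × ℝ}
    (hx : IsPeriodicSolution3 (F μ) x) (hδ : ∀ t, ‖x t‖ < δ) (h1 : |d.c2| * δ ≤ |d.c1| / 2)
    (h2 : 3 * d.K * δ ≤ |d.ω| / 2) :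
    ∃ (u r θ : ℝ → ℝ) (T : ℝ) (k : ℤ), 0 < T ∧ k ≠ 0 ∧ (∀ t, u (t + T) = u t) ∧
      (∀ t, r (t + T) = r t) ∧ (∀ t, θ (t + T) = θ t + k * (2 * π)) ∧
      (∀ t, 0 < r t) ∧ (∀ t, r t < 2 * δ) ∧ (∀ t, |u t| < δ) ∧
      (∀ t, x t = (u t, r t * cos (θ t), r t * sin (θ t))) ∧
      (∀ t, HasDerivAt u (d.c1 * u t + d.c2 * u t ^ 2 + u t * r t * d.L (θ t) +
        r t ^ 2 * d.H (θ t)) t) ∧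
      (∀ t, HasDerivAt r ((μ + r t * d.A (θ t) + u t * d.B (θ t)) * r t) t) ∧
      (∀ t, HasDerivAt θ (d.ω + r t * d.D (θ t) + u t * d.E (θ t)) t) ∧
      (∀ t, d.ω ^ 2 / 2 ≤ d.ω * (d.ω + r t * d.D (θ t) + u t * d.E (θ t))) := by
  have hpos := nonvanishing hF hx hδ h1
  obtain ⟨hsol, ⟨T, hT, hper⟩, hnc⟩ := hx
  have hd1 : ∀ t, HasDerivAt (fun t => (x t).1) (F μ (x t)).1 t := fun t => (hsol t).fst
  have hd2 : ∀ t, HasDerivAt (fun t => (x t).2.1) (F μ (x t)).2.1 t := fun t => (hsol t).snd.fst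
  have hd3 : ∀ t, HasDerivAt (fun t => (x t).2.2) (F μ (x t)).2.2 t := fun t => (hsol t).snd.snd
  have hxc : Continuous x := continuous_iff_continuousAt.2 fun t => (hsol t).continuousAt
  have hFc : Continuous fun t => F μ (x t) := (hF.1 μ).comp hxc
  let Ω : ℝ → ℝ := fun t => ((x t).2.1 * (F μ (x t)).2.2 - (x t).2.2 * (F μ (x t)).2.1) /
    ((x t).2.1 ^ 2 + (x t).2.2 ^ 2)
  let a : ℝ → ℝ := fun t => ((x t).2.1 * (F μ (x t)).2.1 + (x t).2.2 * (F μ (x t)).2.2) /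
    ((x t).2.1 ^ 2 + (x t).2.2 ^ 2)
  have hΩc : Continuous Ω := by
    have c1 : Continuous fun t => (F μ (x t)).2.1 := hFc.snd.fst
    have c2 : Continuous fun t => (F μ (x t)).2.2 := hFc.snd.snd
    have c3 : Continuous fun t => (x t).2.1 := hxc.snd.fst
    have c4 : Continuous fun t => (x t).2.2 := hxc.snd.snd
    exact Continuous.div ((c3.mul c2).sub (c4.mul c1)) ((c3.pow 2).add (c4.pow 2))
      fun t => (hpos t).ne'
  obtain ⟨θ, hθ, hr, hv, hw⟩ := polar_lift (v := fun t => (x t).2.1) (w := fun t => (x t).2.2)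
    (a := a) hΩc hpos
    (fun t => (hd2 t).congr_deriv (by
      have := (hpos t).ne'
      simp only [a, Ω]
      field_simp
      ring))
    (fun t => (hd3 t).congr_deriv (by
      have := (hpos t).ne'
      simp only [a, Ω]
      field_simp
      ring))
  set r : ℝ → ℝ := fun t => √((x t).2.1 ^ 2 + (x t).2.2 ^ 2) with hrdef
  have hrpos : ∀ t, 0 < r t := fun t => Real.sqrt_pos.2 (hpos t)
  have hrsq : ∀ t, (x t).2.1 ^ 2 + (x t).2.2 ^ 2 = r t ^ 2 := fun t => (Real.sq_sqrt (hpos t).le).symm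
  have hv' : ∀ t, (x t).2.1 = r t * cos (θ t) := hv
  have hw' : ∀ t, (x t).2.2 = r t * sin (θ t) := hw
  have hxe : ∀ t, x t = ((x t).1, r t * cos (θ t), r t * sin (θ t)) := by
    intro t
    rw [← hv' t, ← hw' t]
  have hfx := fun t => hF.2 μ (x t).1 (r t) (θ t) (hrpos t).le
  simp only [← hxe] at hfx
  have ha : ∀ t, a t = μ + r t * d.A (θ t) + (x t).1 * d.B (θ t) := by
    intro t
    simp only [a]
    rw [hrsq, hfx]
    simp only
    rw [hv' t, hw' t, div_eq_iff (pow_pos (hrpos t) 2).ne']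
    linear_combination (μ + r t * d.A (θ t) + (x t).1 * d.B (θ t)) * r t ^ 2 *
      Real.sin_sq_add_cos_sq (θ t)
  have hΩ : ∀ t, Ω t = d.ω + r t * d.D (θ t) + (x t).1 * d.E (θ t) := by
    intro t
    simp only [Ω]
    rw [hrsq, hfx]
    simp only
    rw [hv' t, hw' t, div_eq_iff (pow_pos (hrpos t) 2).ne']
    linear_combination (d.ω + r t * d.D (θ t) + (x t).1 * d.E (θ t)) * r t ^ 2 *
      Real.sin_sq_add_cos_sq (θ t)
  have hωpos := abs_pos.2 d.hω
  have hlow : ∀ t, d.ω ^ 2 / 2 ≤ d.ω * Ω t := by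
    intro t
    rw [hΩ t]
    obtain ⟨b1, b2⟩ := comps_lt (hδ t)
    have hb := (bound_three (d.bD (θ t)) (d.bE (θ t)) (hrpos t).le b2 b1).trans h2
    have h3 : |d.ω * (r t * d.D (θ t) + (x t).1 * d.E (θ t))| ≤ d.ω ^ 2 / 2 := by
      rw [abs_mul, ← sq_abs d.ω]
      nlinarith
    have := neg_abs_le (d.ω * (r t * d.D (θ t) + (x t).1 * d.E (θ t)))
    nlinarith
  have hrper : ∀ t, r (t + T) = r t := fun t => by simp only [hrdef, hper]
  have hΩper : ∀ t, Ω (t + T) = Ω t := fun t => by simp only [Ω, hper]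
  obtain ⟨k, hk⟩ : ∃ k : ℤ, θ (0 + T) - θ 0 = 2 * π * k := by
    rw [← Real.Angle.angle_eq_iff_two_pi_dvd_sub]
    refine Real.Angle.cos_sin_inj ?_ ?_
    · have := hv' (0 + T)
      rw [hper, hrper, hv' 0] at this
      exact (mul_left_cancel₀ (hrpos 0).ne' this).symm
    · have := hw' (0 + T)
      rw [hper, hrper, hw' 0] at this
      exact (mul_left_cancel₀ (hrpos 0).ne' this).symm
  have hθper : ∀ t, θ (t + T) = θ t + k * (2 * π) := by
    intro t
    have h3 : ∀ t, HasDerivAt (fun t => θ (t + T) - θ t) 0 t := fun t =>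
      ((HasDerivAt.comp_add_const t T (hθ (t + T))).sub (hθ t)).congr_deriv
        (by rw [hΩper, sub_self])
    have := const_of_hasDerivAt_zero h3 t 0
    rw [hk] at this
    linarith
  have hk0 : k ≠ 0 := by
    rintro rfl
    obtain ⟨g, -, hg, -⟩ := global_inverse (w := d.ω) (c := d.ω ^ 2 / 2)
      (by have := pow_pos hωpos 2; rw [sq_abs] at this; linarith) hθ hlow
    have h3 := hθper 0
    simp only [Int.cast_zero, zero_mul, add_zero, zero_add] at h3
    have h4 := hg T
    rw [h3, hg] at h4
    exact hT.ne h4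
  refine ⟨fun t => (x t).1, r, θ, T, k, hT, hk0, fun t => by simp only [hper], hrper, hθper,
    hrpos, fun t => (comps_lt (hδ t)).2, fun t => (comps_lt (hδ t)).1, hxe, fun t => ?_,
    fun t => ?_, fun t => ?_, fun t => ?_⟩
  · exact (hd1 t).congr_deriv (by rw [hfx])
  · exact (hr t).congr_deriv (by rw [ha])
  · exact (hθ t).congr_deriv (hΩ t)
  · rw [← hΩ]; exact hlow t
end PD

namespace PD
variable {d : PD} {F : ℝ → ℝ × ℝ × ℝ → ℝ × ℝ × ℝ}

/-- A small periodic solution is a periodic solution of the reduced system. -/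
lemma apriori (hF : d.IsField F) {m δ Y : ℝ} {x : ℝ → ℝ × ℝ × ℝ} (hm0 : m ≠ 0)
    (hY : 2 * d.K / |d.c1| + 1 ≤ Y)
    (hx : IsPeriodicSolution3 (F (-d.α * m)) x) (hδ : ∀ t, ‖x t‖ < δ)
    (h2 : 3 * d.K * δ ≤ |d.ω| / 2)
    (h3 : |d.c2| * δ + 8 * d.K * δ + 2 * |d.α| * |m| ≤ |d.c1| / 2)
    (h4 : 2 * δ * Y * d.K + (d.K + |d.α|) * (3 * d.K * δ) / |d.ω| ≤ |d.α| / 4)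
    (h5 : |m| * d.K / |d.ω| ≤ 1 / 8) :
    0 < m ∧ ∃ (τ Q y : ℝ → ℝ) (N : ℕ), 0 < N ∧ (∀ θ, Q (θ + N * (2 * π)) = Q θ) ∧
      (∀ θ, y (θ + N * (2 * π)) = y θ) ∧
      (∀ θ, HasDerivAt Q (d.F1 m θ (Q θ) (y θ)) θ) ∧
      (∀ θ, HasDerivAt y (d.F2 m θ (Q θ) (y θ)) θ) ∧
      (∀ θ, |Q θ - 1| ≤ 1 / 2) ∧ (∀ θ, |y θ| ≤ Y) ∧
      (∀ θ, HasDerivAt τ (d.Om m θ (Q θ) (y θ))⁻¹ θ) ∧ (∀ t, ∃ θ, τ θ = t) ∧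
      (∀ θ, x (τ θ) = ((m / Q θ) ^ 2 * y θ, m / Q θ * cos θ, m / Q θ * sin θ)) := by
  have hωpos := abs_pos.2 d.hω
  have hαpos := abs_pos.2 d.hα
  have hc1pos := abs_pos.2 d.hc1
  have hKpos := d.hK
  have hmpos := abs_pos.2 hm0
  have hδpos : 0 < δ := (norm_nonneg _).trans_lt (hδ 0)
  have h1 : |d.c2| * δ ≤ |d.c1| / 2 := by
    have : 0 ≤ 8 * d.K * δ := by positivity
    have : 0 ≤ 2 * |d.α| * |m| := by positivity
    linarith
  obtain ⟨u, r, θ, T, k, hT, hk, pu, pr, pθ, rpos, rb, ub, hxe, du, dr, dθ, hlow⟩ :=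
    to_polar hF hx hδ h1 h2
  -- the scaled variables in time
  let y : ℝ → ℝ := fun t => u t / r t ^ 2
  let Q : ℝ → ℝ := fun t => m / r t
  have hu : ∀ t, u t = r t ^ 2 * y t := fun t => by
    have := (rpos t).ne'
    simp only [y]
    field_simp
  have dy : ∀ t, HasDerivAt y (d.c1 * y t + d.H (θ t) + y t * (d.c2 * u t + r t * d.L (θ t)
      - 2 * (-d.α * m + r t * d.A (θ t) + u t * d.B (θ t)))) t := by
    intro t
    have hr := (rpos t).ne'
    refine ((du t).div ((dr t).pow 2) (pow_ne_zero 2 hr)).congr_deriv ?_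
    simp only [y, Pi.pow_apply, Nat.cast_ofNat, Nat.add_one_sub_one, pow_one]
    field_simp
    ring
  have dQ : ∀ t, HasDerivAt Q (m * (d.α * Q t - d.A (θ t) - r t * y t * d.B (θ t))) t := by
    intro t
    have hr := (rpos t).ne'
    refine ((hasDerivAt_const t m).div (dr t) hr).congr_deriv ?_
    simp only [y, Q]
    field_simp
    ring
  have py : ∀ t, y (t + T) = y t := fun t => by simp only [y, pu, pr]
  have pQ : ∀ t, Q (t + T) = Q t := fun t => by simp only [Q, pr]
  have by0 : ∀ t, |y t| ≤ Y := by
    intro t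
    have := max_principle (l := d.c1) (K := d.K) (M := |d.c1| / 2) hT py dy
      (by linarith) (fun t => by
        have e : d.c1 * y t + d.H (θ t) + y t * (d.c2 * u t + r t * d.L (θ t)
          - 2 * (-d.α * m + r t * d.A (θ t) + u t * d.B (θ t))) - d.c1 * y t =
          d.H (θ t) + (d.c2 * u t + r t * d.L (θ t)
          + 2 * (d.α * m) - 2 * (r t * d.A (θ t) + u t * d.B (θ t))) * y t := by ring
        rw [e]
        refine (abs_add_le _ _).trans (add_le_add (d.bH _) ?_)
        rw [abs_mul]
        refine mul_le_mul_of_nonneg_right (le_trans ?_ h3) (abs_nonneg _)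
        have a1 : |d.c2 * u t| ≤ |d.c2| * δ := by
          rw [abs_mul]; exact mul_le_mul_of_nonneg_left (ub t).le (abs_nonneg _)
        have a2 : |r t * d.L (θ t)| ≤ 2 * δ * d.K := by
          rw [abs_mul, abs_of_pos (rpos t)]
          exact mul_le_mul (rb t).le (d.bL _) (abs_nonneg _) (by positivity)
        have a3 : |2 * (d.α * m)| = 2 * |d.α| * |m| := by
          rw [abs_mul, abs_mul, abs_two]; ring
        have a4 : |2 * (r t * d.A (θ t) + u t * d.B (θ t))| ≤ 2 * (3 * d.K * δ) := by
          rw [abs_mul, abs_two]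
          exact mul_le_mul_of_nonneg_left
            (bound_three (d.bA _) (d.bB _) (rpos t).le (rb t) (ub t)) zero_le_two
        have b1 := abs_sub (d.c2 * u t + r t * d.L (θ t) + 2 * (d.α * m))
          (2 * (r t * d.A (θ t) + u t * d.B (θ t)))
        have b2 := abs_add_le (d.c2 * u t + r t * d.L (θ t)) (2 * (d.α * m))
        have b3 := abs_add_le (d.c2 * u t) (r t * d.L (θ t))
        linarith) t
    have h6 : |y t| ≤ 2 * d.K / |d.c1| := by
      rw [le_div_iff₀ hc1pos]
      linarith
    linarith
  have hY0 : 0 ≤ Y := (abs_nonneg _).trans (by0 0)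
  have pP : ∀ t, d.P (θ (t + T)) = d.P (θ t) := by
    intro t
    rw [pθ]
    exact (Function.Periodic.int_mul (f := d.P) (c := 2 * π) d.pP k) (θ t)
  have bQ : ∀ t, |Q t - 1| ≤ 1 / 2 := by
    intro t
    have hd : ∀ t, HasDerivAt (fun t => Q t - 1 + m / d.ω * d.P (θ t)) (m * (d.α * Q t - d.A (θ t)
        - r t * y t * d.B (θ t)) + m / d.ω * ((d.A (θ t) - d.α) *
          (d.ω + r t * d.D (θ t) + u t * d.E (θ t)))) t := fun t =>
      ((dQ t).sub_const 1).add (((d.dP (θ t)).comp t (dθ t)).const_mul (m / d.ω))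
    have := max_principle (l := m * d.α) (M := 0)
      (K := |m| * (|d.α| / 4) + |m| * |d.α| * (1 / 8)) hT
      (fun t => by simp only [pQ, pP]) hd (abs_nonneg _) (fun t => by
        have hω := d.hω
        have e : m * (d.α * Q t - d.A (θ t) - r t * y t * d.B (θ t)) +
          m / d.ω * ((d.A (θ t) - d.α) * (d.ω + r t * d.D (θ t) + u t * d.E (θ t))) -
          m * d.α * (Q t - 1 + m / d.ω * d.P (θ t)) =
          m * ((d.A (θ t) - d.α) * (r t * d.D (θ t) + u t * d.E (θ t)) / d.ω
            - r t * y t * d.B (θ t)) - m * d.α * (m * d.P (θ t) / d.ω) := by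
          field_simp
          ring
        rw [e, zero_mul, add_zero]
        refine (abs_sub _ _).trans (add_le_add ?_ ?_)
        · rw [abs_mul]
          refine mul_le_mul_of_nonneg_left (le_trans ?_ h4) (abs_nonneg _)
          refine (abs_sub _ _).trans ?_
          rw [add_comm]
          refine add_le_add ?_ ?_
          · rw [abs_mul, abs_mul, abs_of_pos (rpos t)]
            exact mul_le_mul (mul_le_mul (rb t).le (by0 t) (abs_nonneg _) (by positivity))
              (d.bB _) (abs_nonneg _) (by positivity)
          · rw [abs_div, abs_mul]
            refine div_le_div_of_nonneg_right ?_ hωpos.le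
            refine mul_le_mul ((abs_sub _ _).trans (add_le_add_left (d.bA _) _))
              (bound_three (d.bD _) (d.bE _) (rpos t).le (rb t) (ub t)) (abs_nonneg _)
              (by positivity)
        · rw [abs_mul, abs_mul]
          refine mul_le_mul_of_nonneg_left (le_trans ?_ h5) (by positivity)
          rw [abs_div, abs_mul]
          exact div_le_div_of_nonneg_right
            (mul_le_mul_of_nonneg_left (d.bP _) (abs_nonneg _)) hωpos.le) t
    rw [sub_zero, abs_mul] at this
    have h6 : |Q t - 1 + m / d.ω * d.P (θ t)| ≤ 3 / 8 := by
      refine le_of_mul_le_mul_left (this.trans (le_of_eq ?_)) (mul_pos hmpos hαpos)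
      ring
    have h7 : |m / d.ω * d.P (θ t)| ≤ 1 / 8 := by
      refine le_trans ?_ h5
      rw [abs_mul, abs_div]
      refine (mul_le_mul_of_nonneg_left (d.bP (θ t)) (by positivity)).trans (le_of_eq ?_)
      ring
    have h8 := abs_sub (Q t - 1 + m / d.ω * d.P (θ t)) (m / d.ω * d.P (θ t))
    rw [add_sub_cancel_right] at h8
    linarith
  have hQpos : ∀ t, 0 < Q t := fun t => by
    have := (abs_le.1 (bQ t)).1
    linarith
  have hmp : 0 < m := by
    have h6 := mul_pos (hQpos 0) (rpos 0)
    have := (rpos 0).ne'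
    simp only [Q] at h6
    rwa [div_mul_cancel₀ _ this] at h6
  refine ⟨hmp, ?_⟩
  have hω2 : 0 < d.ω ^ 2 / 2 := by
    have := pow_pos hωpos 2
    rw [sq_abs] at this
    linarith
  obtain ⟨τ, hτ1, hτ2, hτd⟩ := global_inverse hω2 dθ hlow
  have hr : ∀ t, r t = m / Q t := fun t => by
    have := (rpos t).ne'
    simp only [Q]
    field_simp
  have hOm : ∀ φ, d.ω + r (τ φ) * d.D (θ (τ φ)) + u (τ φ) * d.E (θ (τ φ)) =
      d.Om m φ (Q (τ φ)) (y (τ φ)) := by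
    intro φ
    rw [hτ1, hu, hr]
    unfold Om W
    ring
  have hOne : ∀ φ, d.Om m φ (Q (τ φ)) (y (τ φ)) ≠ 0 := by
    intro φ
    refine d.Om_ne ?_
    rw [← hOm]
    exact hlow _
  have hτd' : ∀ φ, HasDerivAt τ (d.Om m φ (Q (τ φ)) (y (τ φ)))⁻¹ φ := by
    intro φ
    rw [← hOm]
    exact hτd φ
  have hτp : ∀ φ, τ (φ + k * (2 * π)) = τ φ + T := by
    intro φ
    rw [← hτ2 (τ φ + T), pθ, hτ1]
  have abs_per : ∀ f : ℝ → ℝ, (∀ φ, f (φ + k * (2 * π)) = f φ) →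
      ∀ φ, f (φ + (k.natAbs : ℝ) * (2 * π)) = f φ := by
    intro f hf φ
    have hcast : ((k.natAbs : ℝ)) = |(k : ℝ)| := by
      rw [← Int.cast_abs, ← Int.natCast_natAbs, Int.cast_natCast]
    rw [hcast]
    rcases abs_choice (k : ℝ) with h | h
    · rw [h]; exact hf φ
    · rw [h, ← hf]
      congr 1
      ring
  refine ⟨τ, fun φ => Q (τ φ), fun φ => y (τ φ), k.natAbs, Int.natAbs_pos.2 hk,
    abs_per (fun φ => Q (τ φ)) (fun φ => by simp only [hτp, pQ]),
    abs_per (fun φ => y (τ φ)) (fun φ => by simp only [hτp, py]),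
    fun φ => ?_, fun φ => ?_, fun φ => bQ _, fun φ => by0 _, hτd', fun t => ⟨θ t, hτ2 t⟩,
    fun φ => ?_⟩
  · refine ((dQ (τ φ)).comp φ (hτd' φ)).congr_deriv ?_
    rw [hτ1, hr]
    unfold F1
    ring
  · refine ((dy (τ φ)).comp φ (hτd' φ)).congr_deriv ?_
    rw [hτ1, hu, hr]
    unfold F2 Br
    ring
  · rw [hxe, hu, hτ1, hr]

/-- From the reduced system back to a periodic solution. -/
lemma from_theta (hF : d.IsField F) {m Y : ℝ} (hm : 0 < m) {Q y : ℝ → ℝ}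
    (hO : ∀ θ Q y, 1/2 ≤ Q → Q ≤ 3/2 → |y| ≤ Y → d.ω ^ 2 / 2 ≤ d.ω * d.Om m θ Q y)
    (pQ : ∀ θ, Q (θ + 2 * π) = Q θ) (py : ∀ θ, y (θ + 2 * π) = y θ)
    (dQ : ∀ θ, HasDerivAt Q (d.F1 m θ (Q θ) (y θ)) θ)
    (dy : ∀ θ, HasDerivAt y (d.F2 m θ (Q θ) (y θ)) θ)
    (bQ : ∀ θ, |Q θ - 1| ≤ 1 / 2) (hy : ∀ θ, |y θ| ≤ Y) :
    ∃ (x : ℝ → ℝ × ℝ × ℝ) (θ : ℝ → ℝ), IsPeriodicSolution3 (F (-d.α * m)) x ∧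
      ∀ t, x t = ((m / Q (θ t)) ^ 2 * y (θ t), m / Q (θ t) * cos (θ t),
        m / Q (θ t) * sin (θ t)) := by
  have hQ1 : ∀ θ, 1/2 ≤ Q θ := fun θ => by linarith [(abs_le.1 (bQ θ)).1]
  have hQ2 : ∀ θ, Q θ ≤ 3/2 := fun θ => by linarith [(abs_le.1 (bQ θ)).2]
  have hQpos : ∀ θ, 0 < Q θ := fun θ => by linarith [hQ1 θ]
  have hlow : ∀ θ, d.ω ^ 2 / 2 ≤ d.ω * d.Om m θ (Q θ) (y θ) := fun θ =>
    hO θ _ _ (hQ1 θ) (hQ2 θ) (hy θ)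
  have hne : ∀ θ, d.Om m θ (Q θ) (y θ) ≠ 0 := fun θ => d.Om_ne (hlow θ)
  have hω2 : 0 < d.ω ^ 2 / 2 := by
    have := pow_pos (abs_pos.2 d.hω) 2
    rw [sq_abs] at this
    linarith
  have cQ : Continuous Q := continuous_iff_continuousAt.2 fun t => (dQ t).continuousAt
  have cy : Continuous y := continuous_iff_continuousAt.2 fun t => (dy t).continuousAt
  have cO : Continuous fun θ => d.Om m θ (Q θ) (y θ) := by
    have cQi : Continuous fun θ => (Q θ)⁻¹ := cQ.inv₀ fun θ => (hQpos θ).ne'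
    have := d.cD
    have := d.cE
    unfold Om W
    fun_prop
  have pO : Function.Periodic (fun θ => d.Om m θ (Q θ) (y θ)) (2 * π) := fun θ => by
    simp only [Om, W, d.pD, d.pE, pQ, py]
  obtain ⟨B, hB⟩ := (pO.isBounded_of_continuous (by positivity) cO).exists_norm_le
  have hB' : ∀ θ, |d.Om m θ (Q θ) (y θ)| ≤ B := fun θ => hB _ ⟨θ, rfl⟩
  have hBpos : 0 < B := (abs_pos.2 (hne 0)).trans_le (hB' 0)
  have cOi : Continuous fun θ => (d.Om m θ (Q θ) (y θ))⁻¹ := cO.inv₀ hne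
  let s : ℝ → ℝ := fun θ => ∫ φ in (0:ℝ)..θ, (d.Om m φ (Q φ) (y φ))⁻¹
  have ds : ∀ θ, HasDerivAt s (d.Om m θ (Q θ) (y θ))⁻¹ θ := fun θ =>
    intervalIntegral.integral_hasDerivAt_right (cOi.intervalIntegrable _ _)
      cOi.aestronglyMeasurable.stronglyMeasurableAtFilter cOi.continuousAt
  obtain ⟨θ, hθ1, hθ2, dθ⟩ := global_inverse (w := d.ω) (c := d.ω ^ 2 / 2 / B ^ 2)
    (by positivity) ds (fun θ => by
      have h1 := hlow θ
      have h2 := hB' θ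
      have h3 := hne θ
      generalize d.Om m θ (Q θ) (y θ) = O at *
      have h4 : O ^ 2 ≤ B ^ 2 := sq_le_sq' (by linarith [neg_abs_le O]) (by linarith [le_abs_self O])
      have h5 : 0 < O ^ 2 := by positivity
      have e : d.ω * O⁻¹ = d.ω * O / O ^ 2 := by field_simp
      rw [e]
      exact div_le_div₀ (hω2.le.trans h1) h1 h5 h4)
  simp only [inv_inv] at dθ
  have ps : ∀ φ, s (φ + 2 * π) = s φ + (s (2 * π) - s 0) := by
    intro φ
    have h3 : ∀ t, HasDerivAt (fun t => s (t + 2 * π) - s t) 0 t := fun t =>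
      ((HasDerivAt.comp_add_const t (2 * π) (ds (t + 2 * π))).sub (ds t)).congr_deriv (by
        have := pO t
        simp only at this
        rw [this, sub_self])
    have := const_of_hasDerivAt_zero h3 φ 0
    rw [zero_add] at this
    linarith
  set T := s (2 * π) - s 0 with hT
  have hT0 : T ≠ 0 := by
    intro h
    have h1 : s (2 * π) = s 0 := by linarith
    have h2 := hθ2 (2 * π)
    rw [h1, hθ2] at h2
    linarith [Real.pi_pos]
  have pθ : ∀ t, θ (t + T) = θ t + 2 * π := by
    intro t
    rw [← hθ2 (θ t + 2 * π), ps, hθ1]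
  let X : ℝ → ℝ × ℝ × ℝ := fun φ => ((m / Q φ) ^ 2 * y φ, m / Q φ * cos φ, m / Q φ * sin φ)
  have pX : ∀ t, X (θ (t + T)) = X (θ t) := by
    intro t
    simp only [X, pθ, pQ, py, Real.cos_add_two_pi, Real.sin_add_two_pi]
  refine ⟨fun t => X (θ t), θ, ⟨?_, ⟨|T|, abs_pos.2 hT0, ?_⟩, ?_⟩, fun t => rfl⟩
  · intro t
    have dQt : HasDerivAt (fun t => Q (θ t)) (m * (d.α * Q (θ t) - d.A (θ t)
        - m * (Q (θ t))⁻¹ * y (θ t) * d.B (θ t))) t := by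
      refine ((dQ (θ t)).comp t (dθ t)).congr_deriv ?_
      unfold F1
      rw [mul_assoc, inv_mul_cancel₀ (hne (θ t)), mul_one]
    have dyt : HasDerivAt (fun t => y (θ t)) (d.c1 * y (θ t) + d.H (θ t)
        + m * y (θ t) * d.Br m (θ t) (Q (θ t)) (y (θ t))) t := by
      refine ((dy (θ t)).comp t (dθ t)).congr_deriv ?_
      unfold F2
      rw [mul_assoc, inv_mul_cancel₀ (hne (θ t)), mul_one]
    have hq := hQpos (θ t)
    have drt : HasDerivAt (fun t => m / Q (θ t)) ((-d.α * m + m / Q (θ t) * d.A (θ t) +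
        (m / Q (θ t)) ^ 2 * y (θ t) * d.B (θ t)) * (m / Q (θ t))) t := by
      refine ((hasDerivAt_const t m).div dQt hq.ne').congr_deriv ?_
      field_simp
      ring
    have hOe : d.Om m (θ t) (Q (θ t)) (y (θ t)) = d.ω + m / Q (θ t) * d.D (θ t) +
        (m / Q (θ t)) ^ 2 * y (θ t) * d.E (θ t) := by
      unfold Om W
      ring
    rw [hF.2 _ _ _ _ (div_pos hm hq).le]
    refine HasDerivAt.prodMk ?_ (HasDerivAt.prodMk ?_ ?_)
    · refine ((drt.fun_pow 2).fun_mul dyt).congr_deriv ?_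
      unfold Br
      simp only [Nat.cast_ofNat, Nat.add_one_sub_one, pow_one]
      field_simp
      ring
    · refine (drt.fun_mul (dθ t).cos).congr_deriv ?_
      rw [hOe]
      ring
    · refine (drt.fun_mul (dθ t).sin).congr_deriv ?_
      rw [hOe]
      ring
  · intro t
    rcases abs_choice T with h | h
    · simp only [h, pX]
    · have := pX (t + -T)
      rw [neg_add_cancel_right] at this
      simp only [h, this]
  · intro hcon
    have h1 := hcon (s 0)
    have h2 := hcon (s π)
    simp only [hθ2] at h1 h2
    rw [← h1] at h2
    have h3 : m / Q π * cos π = m / Q 0 * cos 0 := congrArg (fun p : ℝ × ℝ × ℝ => p.2.1) h2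
    rw [Real.cos_pi, Real.cos_zero] at h3
    have h4 := div_pos hm (hQpos π)
    have h5 := div_pos hm (hQpos 0)
    linarith

/-- The main theorem for polar data. -/
lemma main (hF : d.IsField F) : ∃ ε > 0, ∃ δ > 0, ∃ C > 0, ∀ m : ℝ, m ≠ 0 → |m| ≤ ε →
    (0 < m → ∃ x : ℝ → ℝ × ℝ × ℝ, IsPeriodicSolution3 (F (-d.α * m)) x ∧
      (∀ t, ‖x t‖ < δ) ∧ 0 < ampl3 x ∧ ampl3 x < δ ∧ |ampl3 x - m| ≤ C * m ^ 2 ∧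
      (∀ t, |(x t).1| ≤ C * m ^ 2)) ∧
    (∀ x₁ x₂ : ℝ → ℝ × ℝ × ℝ,
      IsPeriodicSolution3 (F (-d.α * m)) x₁ → IsPeriodicSolution3 (F (-d.α * m)) x₂ →
      (∀ t, ‖x₁ t‖ < δ) → (∀ t, ‖x₂ t‖ < δ) → ∃ s : ℝ, ∀ t, x₂ t = x₁ (t + s)) ∧
    (m < 0 → ¬ ∃ x : ℝ → ℝ × ℝ × ℝ, IsPeriodicSolution3 (F (-d.α * m)) x ∧ ∀ t, ‖x t‖ < δ) := by
  have hωpos := abs_pos.2 d.hω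
  have hαpos := abs_pos.2 d.hα
  have hc1pos := abs_pos.2 d.hc1
  have hKpos := d.hK
  set Y : ℝ := 2 * d.K / |d.c1| + 1 with hYdef
  have hYpos : 0 < Y := by positivity
  obtain ⟨m0, C0, hm0, hm01, hC0, hth⟩ := d.theta_system Y le_rfl
  -- choice of δ
  obtain ⟨δ, hδ, hδ2, hδ3, hδ4⟩ : ∃ δ, 0 < δ ∧ 3 * d.K * δ ≤ |d.ω| / 2 ∧
      |d.c2| * δ + 8 * d.K * δ ≤ |d.c1| / 4 ∧
      2 * δ * Y * d.K + (d.K + |d.α|) * (3 * d.K * δ) / |d.ω| ≤ |d.α| / 4 := by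
    have key : ∀ k c : ℝ, 0 < k → 0 < c → ∃ δ, 0 < δ ∧ ∀ δ', δ' ≤ δ → k * δ' ≤ c := by
      intro k c hk hc
      refine ⟨c / k, by positivity, fun δ' h => ?_⟩
      rw [le_div_iff₀ hk] at h
      linarith
    obtain ⟨δ1, p1, q1⟩ := key (3 * d.K) (|d.ω| / 2) (by positivity) (by positivity)
    obtain ⟨δ2, p2, q2⟩ := key (|d.c2| + 8 * d.K) (|d.c1| / 4) (by positivity) (by positivity)
    obtain ⟨δ3, p3, q3⟩ := key (2 * Y * d.K + (d.K + |d.α|) * (3 * d.K) / |d.ω|) (|d.α| / 4)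
      (by positivity) (by positivity)
    refine ⟨min δ1 (min δ2 δ3), by positivity, q1 _ (min_le_left _ _), ?_, ?_⟩
    · have := q2 (min δ1 (min δ2 δ3)) ((min_le_right _ _).trans (min_le_left _ _))
      linarith
    · have := q3 (min δ1 (min δ2 δ3)) ((min_le_right _ _).trans (min_le_right _ _))
      refine le_trans (le_of_eq ?_) this
      ring
  refine ⟨min m0 (min (|d.c1| / (8 * |d.α|)) (min (|d.ω| / (8 * d.K)) (min (δ / 4)
    (δ / (8 * Y))))), by positivity, δ, hδ, max (2 * C0) (4 * Y), by positivity, ?_⟩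
  intro m hmne hm
  obtain ⟨k1, hm⟩ := le_min_iff.1 hm
  obtain ⟨k2, hm⟩ := le_min_iff.1 hm
  obtain ⟨k3, hm⟩ := le_min_iff.1 hm
  obtain ⟨k4, k5⟩ := le_min_iff.1 hm
  rw [le_div_iff₀ (by positivity)] at k2 k3 k4 k5
  have hmpos := abs_pos.2 hmne
  have h3 : |d.c2| * δ + 8 * d.K * δ + 2 * |d.α| * |m| ≤ |d.c1| / 2 := by linarith
  have h5 : |m| * d.K / |d.ω| ≤ 1 / 8 := by
    rw [div_le_iff₀ hωpos]
    linarith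
  obtain ⟨hO, hex, huniq⟩ := hth m hmne k1
  refine ⟨?_, ?_, ?_⟩
  · intro hmp
    obtain ⟨Q, y, pQ, py, dQ, dy, bQ, bQ', hy⟩ := hex
    obtain ⟨x, θ, hx, hxe⟩ := from_theta hF hmp hO pQ py dQ dy bQ' hy
    rw [abs_of_pos hmp] at k1 k4 k5 bQ
    have hQ1 : ∀ θ, 1/2 ≤ Q θ := fun θ => by linarith [(abs_le.1 (bQ' θ)).1]
    have hQpos : ∀ θ, 0 < Q θ := fun θ => by linarith [hQ1 θ]
    have hrpos : ∀ θ, 0 < m / Q θ := fun θ => div_pos hmp (hQpos θ)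
    have hr2 : ∀ θ, m / Q θ ≤ 2 * m := fun θ => by
      rw [div_le_iff₀ (hQpos θ)]
      nlinarith [hQ1 θ]
    have hru : ∀ θ, |m / Q θ - m| ≤ 2 * C0 * m ^ 2 := fun θ => by
      have e : m / Q θ - m = m / Q θ * (-(Q θ - 1)) := by
        have := (hQpos θ).ne'
        field_simp
        ring
      rw [e, abs_mul, abs_neg, abs_of_pos (hrpos θ)]
      have := mul_le_mul (hr2 θ) (bQ θ) (abs_nonneg _) (by positivity)
      linarith
    have hub : ∀ t, |(x t).1| ≤ 4 * Y * m ^ 2 := fun t => by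
      rw [hxe]
      simp only
      rw [abs_mul, abs_of_nonneg (sq_nonneg _)]
      have h6 : (m / Q (θ t)) ^ 2 ≤ (2 * m) ^ 2 := pow_le_pow_left₀ (hrpos _).le (hr2 _) 2
      have := mul_le_mul h6 (hy (θ t)) (abs_nonneg _) (by positivity)
      linarith
    have hamp : ∀ t, √((x t).2.1 ^ 2 + (x t).2.2 ^ 2) = m / Q (θ t) := fun t => by
      rw [hxe]
      simp only
      have e : (m / Q (θ t) * cos (θ t)) ^ 2 + (m / Q (θ t) * sin (θ t)) ^ 2 =
          (m / Q (θ t)) ^ 2 := by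
        linear_combination (m / Q (θ t)) ^ 2 * Real.sin_sq_add_cos_sq (θ t)
      rw [e, Real.sqrt_sq (hrpos _).le]
    have hampl : ampl3 x = ⨆ t, m / Q (θ t) := by
      unfold ampl3
      simp only [hamp]
    have hbdd : BddAbove (Set.range fun t => m / Q (θ t)) := by
      refine ⟨2 * m, ?_⟩
      rintro _ ⟨t, rfl⟩
      exact hr2 _
    have hle : ∀ c, (∀ t, m / Q (θ t) ≤ c) → ampl3 x ≤ c := fun c hc => by
      rw [hampl]; exact ciSup_le hc
    have hge : m / Q (θ 0) ≤ ampl3 x := by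
      rw [hampl]; exact le_ciSup hbdd 0
    have hm2 : 0 ≤ m ^ 2 := sq_nonneg m
    refine ⟨x, hx, fun t => ?_, (hrpos _).trans_le hge, ?_, ?_, fun t => ?_⟩
    · have c1 : |(x t).1| < δ := by
        refine (hub t).trans_lt ?_
        nlinarith
      have c2 : |(x t).2.1| < δ := by
        rw [hxe]
        simp only
        rw [abs_mul, abs_of_pos (hrpos _)]
        have := mul_le_mul (hr2 (θ t)) (Real.abs_cos_le_one (θ t)) (abs_nonneg _) (by positivity)
        linarith
      have c3 : |(x t).2.2| < δ := by
        rw [hxe]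
        simp only
        rw [abs_mul, abs_of_pos (hrpos _)]
        have := mul_le_mul (hr2 (θ t)) (Real.abs_sin_le_one (θ t)) (abs_nonneg _) (by positivity)
        linarith
      exact max_lt c1 (max_lt c2 c3)
    · have := hle _ fun t => hr2 (θ t)
      linarith
    · have h6 := hle (m + 2 * C0 * m ^ 2) fun t => by
        have := (abs_le.1 (hru (θ t))).2
        linarith
      have h7 := (abs_le.1 (hru (θ 0))).1
      have h8 : |ampl3 x - m| ≤ 2 * C0 * m ^ 2 := abs_le.2 ⟨by linarith, by linarith⟩
      exact h8.trans (mul_le_mul_of_nonneg_right (le_max_left _ _) hm2)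
    · exact (hub t).trans (mul_le_mul_of_nonneg_right (le_max_right _ _) hm2)
  · intro x₁ x₂ hx1 hx2 b1 b2
    obtain ⟨hmp, τ₁, Q₁, y₁, N₁, hN₁, pQ1, py1, dQ1, dy1, bQ1, by1, dτ1, sτ1, e1⟩ :=
      apriori hF hmne le_rfl hx1 b1 hδ2 h3 hδ4 h5
    obtain ⟨-, τ₂, Q₂, y₂, N₂, hN₂, pQ2, py2, dQ2, dy2, bQ2, by2, dτ2, sτ2, e2⟩ :=
      apriori hF hmne le_rfl hx2 b2 hδ2 h3 hδ4 h5
    have hN₁' : (0:ℝ) < N₁ := Nat.cast_pos.2 hN₁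
    have hN₂' : (0:ℝ) < N₂ := Nat.cast_pos.2 hN₂
    have per1 : ∀ f : ℝ → ℝ, (∀ θ, f (θ + N₁ * (2 * π)) = f θ) →
        ∀ θ, f (θ + N₁ * N₂ * (2 * π)) = f θ := by
      intro f hf θ
      have := (Function.Periodic.nat_mul (f := f) (c := N₁ * (2 * π)) hf N₂) θ
      rw [← this]
      congr 1
      ring
    have per2 : ∀ f : ℝ → ℝ, (∀ θ, f (θ + N₂ * (2 * π)) = f θ) →
        ∀ θ, f (θ + N₁ * N₂ * (2 * π)) = f θ := by
      intro f hf θ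
      have := (Function.Periodic.nat_mul (f := f) (c := N₂ * (2 * π)) hf N₁) θ
      rw [← this]
      congr 1
      ring
    obtain ⟨hQQ, hyy⟩ := huniq Q₁ y₁ Q₂ y₂ ⟨N₁ * N₂ * (2 * π), by positivity, per1 _ pQ1,
      per1 _ py1, per2 _ pQ2, per2 _ py2⟩ dQ1 dy1 dQ2 dy2 bQ1 by1 bQ2 by2
    subst hQQ hyy
    have hc : ∀ t, HasDerivAt (fun t => τ₁ t - τ₂ t) 0 t := fun t =>
      ((dτ1 t).sub (dτ2 t)).congr_deriv (sub_self _)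
    refine ⟨τ₁ 0 - τ₂ 0, fun t => ?_⟩
    obtain ⟨φ, rfl⟩ := sτ2 t
    have h6 := const_of_hasDerivAt_zero hc φ 0
    have h7 : τ₂ φ + (τ₁ 0 - τ₂ 0) = τ₁ φ := by linarith
    rw [h7, e1, e2]
  · rintro hneg ⟨x, hx, hb⟩
    have := (apriori hF hmne le_rfl hx hb hδ2 h3 hδ4 h5).1
    linarith
end PD


lemma bdd_of_periodic {f : ℝ → ℝ} (hc : Continuous f) (hp : ∀ θ, f (θ + 2 * π) = f θ) :
    ∃ M, 0 ≤ M ∧ ∀ θ, |f θ| ≤ M := by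
  have hP : Function.Periodic f (2 * π) := hp
  obtain ⟨M, hM⟩ := (hP.isBounded_of_continuous (by positivity) hc).exists_norm_le
  have h : ∀ θ, |f θ| ≤ M := fun θ => hM _ ⟨θ, rfl⟩
  exact ⟨M, (abs_nonneg _).trans (h 0), h⟩

/-- The radial coefficient function. -/
noncomputable def radA (a11 a12 a21 a22 b11 b12 b21 b22 θ : ℝ) : ℝ :=
  cos θ * (a11 * cos θ * |cos θ| + a12 * cos θ * |sin θ| +
    a21 * sin θ * |cos θ| + a22 * sin θ * |sin θ|) +
  sin θ * (b11 * cos θ * |cos θ| + b12 * cos θ * |sin θ| +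
    b21 * sin θ * |cos θ| + b22 * sin θ * |sin θ|)

lemma radA_cont (a11 a12 a21 a22 b11 b12 b21 b22 : ℝ) :
    Continuous (radA a11 a12 a21 a22 b11 b12 b21 b22) := by
  unfold radA
  fun_prop

lemma radA_pi (a11 a12 a21 a22 b11 b12 b21 b22 θ : ℝ) :
    radA a11 a12 a21 a22 b11 b12 b21 b22 (θ + π) = radA a11 a12 a21 a22 b11 b12 b21 b22 θ := by
  simp only [radA, cos_add_pi, sin_add_pi, abs_neg]
  ring

lemma radA_piece (a11 a12 a21 a22 b11 b12 b21 b22 e p q : ℝ) (hpq : p ≤ q)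
    (h1 : ∀ θ ∈ Icc p q, |cos θ| = cos θ) (h2 : ∀ θ ∈ Icc p q, |sin θ| = e * sin θ) :
    ∫ θ in p..q, radA a11 a12 a21 a22 b11 b12 b21 b22 θ =
      (a11 * (sin q - sin q ^ 3 / 3) + (a12 * e + a21 + b11) * (- cos q ^ 3 / 3) +
        (a22 * e + b12 * e + b21) * (sin q ^ 3 / 3) + b22 * e * (- cos q + cos q ^ 3 / 3)) -
      (a11 * (sin p - sin p ^ 3 / 3) + (a12 * e + a21 + b11) * (- cos p ^ 3 / 3) +
        (a22 * e + b12 * e + b21) * (sin p ^ 3 / 3) + b22 * e * (- cos p + cos p ^ 3 / 3)) := by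
  refine intervalIntegral.integral_eq_sub_of_hasDerivAt (f := fun q =>
    a11 * (sin q - sin q ^ 3 / 3) + (a12 * e + a21 + b11) * (- cos q ^ 3 / 3) +
        (a22 * e + b12 * e + b21) * (sin q ^ 3 / 3) + b22 * e * (- cos q + cos q ^ 3 / 3))
    (fun θ hθ => ?_) ((radA_cont _ _ _ _ _ _ _ _).intervalIntegrable _ _)
  rw [uIcc_of_le hpq] at hθ
  have hs := hasDerivAt_sin θ
  have hc := hasDerivAt_cos θ
  have hs3 := (hs.pow 3).div_const 3
  have hc3 := (hc.pow 3).div_const 3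
  have hc3n := (hc.pow 3).neg.div_const 3
  have H := ((((hs.sub hs3).const_mul a11).add (hc3n.const_mul (a12 * e + a21 + b11))).add
    (hs3.const_mul (a22 * e + b12 * e + b21))).add ((hc.neg.add hc3).const_mul (b22 * e))
  refine H.congr_deriv ?_
  rw [radA, h1 θ hθ, h2 θ hθ]
  have hsc := sin_sq_add_cos_sq θ
  push_cast
  linear_combination (-(a11 * cos θ) - b22 * e * sin θ) * hsc

lemma radA_int (a11 a12 a21 a22 b11 b12 b21 b22 : ℝ) :
    ∫ θ in (-(π / 2))..(π / 2), radA a11 a12 a21 a22 b11 b12 b21 b22 θ =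
      2 / 3 * (2 * a11 + a12 + b21 + 2 * b22) := by
  have hπ := pi_pos
  have hi : ∀ p q : ℝ, IntervalIntegrable (radA a11 a12 a21 a22 b11 b12 b21 b22)
    MeasureTheory.volume p q := fun p q => (radA_cont _ _ _ _ _ _ _ _).intervalIntegrable _ _
  rw [← intervalIntegral.integral_add_adjacent_intervals (hi _ 0) (hi 0 _),
    radA_piece _ _ _ _ _ _ _ _ (-1) _ _ (by linarith), radA_piece _ _ _ _ _ _ _ _ 1 _ _ (by linarith)]
  · simp only [sin_neg, cos_neg, sin_pi_div_two, cos_pi_div_two, sin_zero, cos_zero]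
    ring
  · exact fun θ h => abs_of_nonneg (cos_nonneg_of_mem_Icc ⟨by linarith [h.1], h.2⟩)
  · exact fun θ h => by
      rw [one_mul, abs_of_nonneg (sin_nonneg_of_nonneg_of_le_pi h.1 (by linarith [h.2]))]
  · exact fun θ h => abs_of_nonneg (cos_nonneg_of_mem_Icc ⟨h.1, by linarith [h.2]⟩)
  · exact fun θ h => by
      rw [neg_one_mul, abs_of_nonpos (sin_nonpos_of_nonpos_of_neg_pi_le h.2 (by linarith [h.1]))]

/-- The concrete system has polar data. -/
lemma exists_PD (ω : ℝ) (hω : ω ≠ 0)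
    (c1 c2 c3 c4 c5 c6 c7 c8 c9 : ℝ) (hc1 : c1 ≠ 0)
    (a11 a12 a21 a22 b11 b12 b21 b22 h11 h12 h21 h22 : ℝ)
    (σ : ℝ) (hσdef : σ = 2 * a11 + a12 + b21 + 2 * b22) (hσ : σ ≠ 0)
    (F : ℝ → ℝ × ℝ × ℝ → ℝ × ℝ × ℝ)
    (hF : ∀ μ x, F μ x =
      (c1 * x.1 + c2 * x.1 ^ 2 + c3 * x.1 * x.2.1 + c4 * x.1 * x.2.2 + c5 * x.2.1 * x.2.2 +
        (h11 * x.2.1 * |x.2.1| + h12 * x.2.1 * |x.2.2| +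
         h21 * x.2.2 * |x.2.1| + h22 * x.2.2 * |x.2.2|),
       μ * x.2.1 - ω * x.2.2 + c6 * x.1 * x.2.1 + c7 * x.1 * x.2.2 +
        (a11 * x.2.1 * |x.2.1| + a12 * x.2.1 * |x.2.2| +
         a21 * x.2.2 * |x.2.1| + a22 * x.2.2 * |x.2.2|),
       ω * x.2.1 + μ * x.2.2 + c8 * x.1 * x.2.1 + c9 * x.1 * x.2.2 +
        (b11 * x.2.1 * |x.2.1| + b12 * x.2.1 * |x.2.2| +
         b21 * x.2.2 * |x.2.1| + b22 * x.2.2 * |x.2.2|))) :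
    ∃ d : PD, d.IsField F ∧ d.α = 2 * σ / (3 * π) := by
  have hπ := pi_pos
  let A : ℝ → ℝ := radA a11 a12 a21 a22 b11 b12 b21 b22
  let B : ℝ → ℝ := fun θ => c6 * cos θ ^ 2 + (c7 + c8) * (cos θ * sin θ) + c9 * sin θ ^ 2
  let D : ℝ → ℝ := fun θ =>
    cos θ * (b11 * cos θ * |cos θ| + b12 * cos θ * |sin θ| +
      b21 * sin θ * |cos θ| + b22 * sin θ * |sin θ|) -
    sin θ * (a11 * cos θ * |cos θ| + a12 * cos θ * |sin θ| +
      a21 * sin θ * |cos θ| + a22 * sin θ * |sin θ|)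
  let E : ℝ → ℝ := fun θ => c8 * cos θ ^ 2 + (c9 - c6) * (cos θ * sin θ) - c7 * sin θ ^ 2
  let H : ℝ → ℝ := fun θ => c5 * (cos θ * sin θ) +
    (h11 * cos θ * |cos θ| + h12 * cos θ * |sin θ| +
      h21 * sin θ * |cos θ| + h22 * sin θ * |sin θ|)
  let L : ℝ → ℝ := fun θ => c3 * cos θ + c4 * sin θ
  let α : ℝ := 2 * σ / (3 * π)
  let P : ℝ → ℝ := fun θ => ∫ φ in (0 : ℝ)..θ, (A φ - α)
  have cA : Continuous A := radA_cont _ _ _ _ _ _ _ _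
  have cB : Continuous B := by fun_prop
  have cD : Continuous D := by fun_prop
  have cE : Continuous E := by fun_prop
  have cH : Continuous H := by fun_prop
  have cL : Continuous L := by fun_prop
  have cAα : Continuous fun φ => A φ - α := cA.sub continuous_const
  have pA' : ∀ θ, A (θ + π) = A θ := radA_pi _ _ _ _ _ _ _ _
  have pA : ∀ θ, A (θ + 2 * π) = A θ := fun θ => by
    rw [show θ + 2 * π = θ + π + π by ring, pA', pA']
  have pB : ∀ θ, B (θ + 2 * π) = B θ := fun θ => by simp only [B, cos_add_two_pi, sin_add_two_pi]
  have pD : ∀ θ, D (θ + 2 * π) = D θ := fun θ => by simp only [D, cos_add_two_pi, sin_add_two_pi]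
  have pE : ∀ θ, E (θ + 2 * π) = E θ := fun θ => by simp only [E, cos_add_two_pi, sin_add_two_pi]
  have pH : ∀ θ, H (θ + 2 * π) = H θ := fun θ => by simp only [H, cos_add_two_pi, sin_add_two_pi]
  have pL : ∀ θ, L (θ + 2 * π) = L θ := fun θ => by simp only [L, cos_add_two_pi, sin_add_two_pi]
  have dP : ∀ θ, HasDerivAt P (A θ - α) θ := fun θ =>
    intervalIntegral.integral_hasDerivAt_right (cAα.intervalIntegrable _ _)
      (cAα.stronglyMeasurableAtFilter _ _) cAα.continuousAt
  have cP : Continuous P := continuous_iff_continuousAt.2 fun θ => (dP θ).continuousAt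
  have pP' : ∀ θ, P (θ + π) = P θ := fun θ => by
    have hper : Function.Periodic (fun φ => A φ - α) π := fun φ => by simp only [pA']
    have h1 := hper.intervalIntegral_add_eq θ (-(π / 2))
    have h0 : ∫ φ in (-(π / 2))..(π / 2), (A φ - α) = 2 / 3 * σ - (π / 2 - -(π / 2)) * α := by
      rw [intervalIntegral.integral_sub (cA.intervalIntegrable _ _)
        (continuous_const.intervalIntegrable _ _), intervalIntegral.integral_const, smul_eq_mul,
        hσdef]
      exact congrArg (· - _) (radA_int _ _ _ _ _ _ _ _)
    rw [show -(π / 2) + π = π / 2 by ring, h0] at h1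
    have h2 : P θ + (∫ φ in θ..(θ + π), (A φ - α)) = P (θ + π) :=
      intervalIntegral.integral_add_adjacent_intervals (cAα.intervalIntegrable _ _)
        (cAα.intervalIntegrable _ _)
    rw [← h2, h1]
    simp only [α]
    field_simp
    ring
  have pP : ∀ θ, P (θ + 2 * π) = P θ := fun θ => by
    rw [show θ + 2 * π = θ + π + π by ring, pP', pP']
  obtain ⟨M1, n1, b1⟩ := bdd_of_periodic cA pA
  obtain ⟨M2, n2, b2⟩ := bdd_of_periodic cB pB
  obtain ⟨M3, n3, b3⟩ := bdd_of_periodic cD pD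
  obtain ⟨M4, n4, b4⟩ := bdd_of_periodic cE pE
  obtain ⟨M5, n5, b5⟩ := bdd_of_periodic cH pH
  obtain ⟨M6, n6, b6⟩ := bdd_of_periodic cL pL
  obtain ⟨M7, n7, b7⟩ := bdd_of_periodic cP pP
  refine ⟨{ ω := ω, c1 := c1, c2 := c2, α := α, K := M1 + M2 + M3 + M4 + M5 + M6 + M7 + 1,
            A := A, B := B, D := D, E := E, H := H, L := L, P := P
            hω := hω, hc1 := hc1, hα := by positivity, hK := by positivity
            cA := cA, cB := cB, cD := cD, cE := cE, cH := cH, cL := cL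
            bA := fun θ => (b1 θ).trans (by linarith)
            bB := fun θ => (b2 θ).trans (by linarith)
            bD := fun θ => (b3 θ).trans (by linarith)
            bE := fun θ => (b4 θ).trans (by linarith)
            bH := fun θ => (b5 θ).trans (by linarith)
            bL := fun θ => (b6 θ).trans (by linarith)
            bP := fun θ => (b7 θ).trans (by linarith)
            pA := pA, pB := pB, pD := pD, pE := pE, pH := pH, pL := pL, pP := pP
            dP := dP }, ⟨fun μ => ?_, fun μ u r θ hr => ?_⟩, rfl⟩
  · rw [funext (hF μ)]
    fun_prop
  · have hsc := sin_sq_add_cos_sq θ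
    rw [hF]
    simp only [A, B, D, E, H, L, radA, abs_mul, abs_of_nonneg hr, Prod.mk.injEq]
    refine ⟨by ring, ?_, ?_⟩
    · linear_combination (-(r * u * (c6 * cos θ + c7 * sin θ)) -
        r ^ 2 * (a11 * cos θ * |cos θ| + a12 * cos θ * |sin θ| +
          a21 * sin θ * |cos θ| + a22 * sin θ * |sin θ|)) * hsc
    · linear_combination (-(r * u * (c8 * cos θ + c9 * sin θ)) -
        r ^ 2 * (b11 * cos θ * |cos θ| + b12 * cos θ * |sin θ| +
          b21 * sin θ * |cos θ| + b22 * sin θ * |sin θ|)) * hsc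


/-- Degenerate Hopf bifurcation for the 3D system (S) with a transversally
hyperbolic direction: if `c₁ ≠ 0` and `σ_# = 2a₁₁ + a₁₂ + b₂₁ + 2b₂₂ ≠ 0`, then for all
small `μ ≠ 0` with `μσ_# < 0` there is a nonconstant periodic solution of planar amplitude
`−3πμ/(2σ_#) + O(μ²)` whose `u`-component is `O(μ²)`, unique up to time translation among
nonconstant periodic solutions with orbit in a small ball around the origin; while for
`μσ_# > 0` there is no such small nonconstant periodic solution. -/
theorem stmt8 (ω : ℝ) (hω : ω ≠ 0)
    (c1 c2 c3 c4 c5 c6 c7 c8 c9 : ℝ) (hc1 : c1 ≠ 0)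
    (a11 a12 a21 a22 b11 b12 b21 b22 h11 h12 h21 h22 : ℝ)
    (σ : ℝ) (hσdef : σ = 2 * a11 + a12 + b21 + 2 * b22) (hσ : σ ≠ 0)
    (F : ℝ → ℝ × ℝ × ℝ → ℝ × ℝ × ℝ)
    (hF : ∀ μ x, F μ x =
      (c1 * x.1 + c2 * x.1 ^ 2 + c3 * x.1 * x.2.1 + c4 * x.1 * x.2.2 + c5 * x.2.1 * x.2.2 +
        (h11 * x.2.1 * |x.2.1| + h12 * x.2.1 * |x.2.2| +
         h21 * x.2.2 * |x.2.1| + h22 * x.2.2 * |x.2.2|),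
       μ * x.2.1 - ω * x.2.2 + c6 * x.1 * x.2.1 + c7 * x.1 * x.2.2 +
        (a11 * x.2.1 * |x.2.1| + a12 * x.2.1 * |x.2.2| +
         a21 * x.2.2 * |x.2.1| + a22 * x.2.2 * |x.2.2|),
       ω * x.2.1 + μ * x.2.2 + c8 * x.1 * x.2.1 + c9 * x.1 * x.2.2 +
        (b11 * x.2.1 * |x.2.1| + b12 * x.2.1 * |x.2.2| +
         b21 * x.2.2 * |x.2.1| + b22 * x.2.2 * |x.2.2|))) :
    ∃ ε > 0, ∃ δ > 0, ∃ C > 0, ∀ μ : ℝ, 0 < |μ| → |μ| < ε →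
      ((μ * σ < 0 →
        ∃ x : ℝ → ℝ × ℝ × ℝ, IsPeriodicSolution3 (F μ) x ∧
          (∀ t, ‖x t‖ < δ) ∧
          0 < ampl3 x ∧ ampl3 x < δ ∧
          |ampl3 x + 3 * π * μ / (2 * σ)| ≤ C * μ ^ 2 ∧
          (∀ t, |(x t).1| ≤ C * μ ^ 2)) ∧
       (∀ x₁ x₂ : ℝ → ℝ × ℝ × ℝ,
          IsPeriodicSolution3 (F μ) x₁ → IsPeriodicSolution3 (F μ) x₂ →
          (∀ t, ‖x₁ t‖ < δ) → (∀ t, ‖x₂ t‖ < δ) →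
          ∃ s : ℝ, ∀ t, x₂ t = x₁ (t + s)) ∧
       (0 < μ * σ →
        ¬ ∃ x : ℝ → ℝ × ℝ × ℝ, IsPeriodicSolution3 (F μ) x ∧ ∀ t, ‖x t‖ < δ)) := by
  have hπ := pi_pos
  obtain ⟨d, hd, hα⟩ := exists_PD ω hω c1 c2 c3 c4 c5 c6 c7 c8 c9 hc1 a11 a12 a21 a22 b11 b12
    b21 b22 h11 h12 h21 h22 σ hσdef hσ F hF
  obtain ⟨ε, hε, δ, hδ, C, hC, h⟩ := d.main hd
  have hα0 := d.hα
  have hαp : 0 < |d.α| := abs_pos.2 hα0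
  have hα2 : 0 < d.α ^ 2 := by positivity
  refine ⟨ε * |d.α|, by positivity, δ, hδ, C / d.α ^ 2, by positivity, fun μ hμ0 hμ => ?_⟩
  have hμ' : μ ≠ 0 := abs_pos.1 hμ0
  obtain ⟨m, hm⟩ : ∃ m, m = -μ / d.α := ⟨_, rfl⟩
  have hμm : -d.α * m = μ := by rw [hm]; field_simp
  have hm0 : m ≠ 0 := by
    rintro rfl
    exact hμ' (by rw [← hμm, mul_zero])
  have hmε : |m| ≤ ε := by
    rw [hm, abs_div, abs_neg, div_le_iff₀ hαp]
    exact hμ.le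
  have hσm : μ * σ = -m * (2 * σ ^ 2 / (3 * π)) := by
    rw [← hμm, hα]; field_simp
  have hpos : 0 < 2 * σ ^ 2 / (3 * π) := by positivity
  have hC2 : C / d.α ^ 2 * μ ^ 2 = C * m ^ 2 := by
    rw [← hμm]; field_simp
  have hmm : 3 * π * μ / (2 * σ) = -m := by
    rw [← hμm, hα]; field_simp
  obtain ⟨hA, hB, hD⟩ := h m hm0 hmε
  rw [hμm] at hA hB hD
  rw [hσm, hC2, hmm]
  refine ⟨fun hneg => ?_, hB, fun hp => hD ?_⟩
  · have : 0 < m := by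
      by_contra hc
      have : 0 ≤ -m * (2 * σ ^ 2 / (3 * π)) := mul_nonneg (by linarith) hpos.le
      linarith
    simpa only [← sub_eq_add_neg] using hA this
  · by_contra hc
    have : 0 ≤ m * (2 * σ ^ 2 / (3 * π)) := mul_nonneg (by linarith) hpos.le
    linarith
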